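/- arXiv:1901.06599 — 5 statements merged into one kernel-verified Lean document; each statement's English description precedes it below -/
import Mathlib

section
/- Let A be a Noetherian domain of finite Krull dimension k and let R be a finitely generated graded domain over A with [R]_0 = A and graded irrelevant ideal m = (R_+). If ht(m) ≥ 1, then there exists a chain of graded prime ideals 0 = P_0 ⊊ P_1 ⊊ ⋯ ⊊ P_k of R such that P_k does not contain m. -/
open AlgebraicGeometry

/-- A strictly increasing finite sequence lifts along a map with the lifting property for `≤`,
starting from any point lying below the first term. -/
theorem exists_strictMono_lift {X Y : Type*} [PartialOrder X] [PartialOrder Y] (f : X → Y)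
    (hf : ∀ x y, f x ≤ y → ∃ x', x ≤ x' ∧ f x' = y) (n : ℕ) (l : Fin (n + 1) → Y)
    (hl : StrictMono l) (x₀ : X) (h₀ : f x₀ ≤ l 0) :
    ∃ p : Fin (n + 1) → X, StrictMono p ∧ p 0 = x₀ := by
  induction n generalizing x₀ with
  | zero => exact ⟨fun _ ↦ x₀, fun i j hij ↦ absurd hij (by omega), rfl⟩
  | succ n ih =>
    have hlt : f x₀ < l (Fin.succ 0) := h₀.trans_lt (hl (Fin.succ_pos 0))
    obtain ⟨x₁, hx₁, hfx₁⟩ := hf x₀ _ hlt.le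
    obtain ⟨p, hp, hp₀⟩ := ih (l ∘ Fin.succ) (hl.comp (Fin.strictMono_succ)) x₁ hfx₁.le
    have hx : x₀ < x₁ := hx₁.lt_of_ne fun h ↦ by
      rw [h, hfx₁] at hlt
      exact hlt.false
    refine ⟨Fin.cons x₀ p, Fin.strictMono_iff_lt_succ.mpr fun i ↦ ?_, rfl⟩
    induction i using Fin.cases with
    | zero => simpa [hp₀] using hx
    | succ i => simpa [← Fin.succ_castSucc] using hp i.castSucc_lt_succ

section GradedDomain

variable {R σ : Type*} [CommRing R] [SetLike σ R] [AddSubgroupClass σ R]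
  (𝒜 : ℕ → σ) [GradedRing 𝒜]

theorem HomogeneousLocalization.Away.fromZeroRingHom_injective [IsDomain R] {f : R} (hf : f ≠ 0) :
    Function.Injective (HomogeneousLocalization.fromZeroRingHom 𝒜 (Submonoid.powers f)) := by
  intro a b hab
  have h : Localization.mk (a : R) (1 : Submonoid.powers f) = Localization.mk (b : R) 1 :=
    congrArg HomogeneousLocalization.val hab
  rw [Localization.mk_one_eq_algebraMap, Localization.mk_one_eq_algebraMap] at h
  have hinj : Function.Injective (algebraMap R (Localization (Submonoid.powers f))) :=
    IsLocalization.injective _ (powers_le_nonZeroDivisors_of_noZeroDivisors hf)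
  exact Subtype.ext (hinj h)

/-- The generic point of `Proj` of a graded domain with nonzero irrelevant ideal. -/
def ProjectiveSpectrum.genericPoint [IsDomain R]
    (h : ¬ HomogeneousIdeal.irrelevant 𝒜 ≤ ⊥) : ProjectiveSpectrum 𝒜 where
  asHomogeneousIdeal := ⊥
  isPrime := by
    rw [HomogeneousIdeal.toIdeal_bot]
    exact Ideal.isPrime_bot
  not_irrelevant_le := h

theorem exists_ne_zero_mem_of_not_irrelevant_le_bot
    (h : ¬ HomogeneousIdeal.irrelevant 𝒜 ≤ ⊥) : ∃ d > 0, ∃ f ∈ 𝒜 d, f ≠ 0 := by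
  classical
  by_contra! hcon
  refine h fun x hx ↦ ?_
  have hx0 : x = 0 := by
    rw [← DirectSum.sum_support_decompose 𝒜 x]
    refine Finset.sum_eq_zero fun i _ ↦ ?_
    rcases Nat.eq_zero_or_pos i with rfl | hi
    · simpa [GradedRing.proj_apply] using (HomogeneousIdeal.mem_irrelevant_iff 𝒜 x).mp hx
    · exact hcon i hi _ (SetLike.coe_mem _)
  rw [hx0]
  exact zero_mem _

theorem Proj.toSpecZero_genericPoint [IsDomain R] (h : ¬ HomogeneousIdeal.irrelevant 𝒜 ≤ ⊥) :
    ((Proj.toSpecZero 𝒜) (ProjectiveSpectrum.genericPoint 𝒜 h) : PrimeSpectrum (𝒜 0)).asIdeal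
      = ⊥ := by
  obtain ⟨d, hd, f, hfd, hf⟩ := exists_ne_zero_mem_of_not_irrelevant_le_bot 𝒜 h
  have : IsDomain (𝒜 0) := Function.Injective.isDomain (algebraMap (𝒜 0) R) Subtype.val_injective
  obtain ⟨y, hy, hy'⟩ := Ideal.exists_comap_eq_of_mem_minimalPrimes_of_injective
    (HomogeneousLocalization.Away.fromZeroRingHom_injective 𝒜 hf) (⊥ : Ideal (𝒜 0))
    (by rw [IsDomain.minimalPrimes_eq_singleton_bot]; rfl)
  let z : Proj 𝒜 := Proj.awayι 𝒜 f hfd hd (⟨y, hy⟩ : PrimeSpectrum _)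
  have hz : ((Proj.toSpecZero 𝒜) z : PrimeSpectrum (𝒜 0)).asIdeal = ⊥ := by
    have hcomp := congrArg (fun φ ↦ φ (⟨y, hy⟩ : PrimeSpectrum _))
      (Proj.awayι_toSpecZero 𝒜 f hfd hd)
    exact (congrArg PrimeSpectrum.asIdeal hcomp).trans hy'
  have hspec : (ProjectiveSpectrum.genericPoint 𝒜 h : Proj 𝒜) ⤳ z := by
    refine specializes_iff_mem_closure.mpr
      ((ProjectiveSpectrum.le_iff_mem_closure 𝒜 _ _).mp ?_)
    exact (bot_le : (⊥ : HomogeneousIdeal 𝒜) ≤ _)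
  have hle := (PrimeSpectrum.le_iff_specializes _ _).mpr
    (hspec.map (Proj.toSpecZero 𝒜).continuous)
  exact le_bot_iff.mp (hz ▸ hle)

/-- Specializations lift along the closed map `Proj 𝒜 ⟶ Spec (𝒜 0)`. -/
theorem Proj.exists_le_toSpecZero_eq [Algebra.FiniteType (𝒜 0) R] (x : ProjectiveSpectrum 𝒜)
    (q : PrimeSpectrum (𝒜 0)) (hq : (show PrimeSpectrum (𝒜 0) from Proj.toSpecZero 𝒜 x) ≤ q) :
    ∃ x' : ProjectiveSpectrum 𝒜, x ≤ x' ∧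
      (show PrimeSpectrum (𝒜 0) from Proj.toSpecZero 𝒜 x') = q := by
  obtain ⟨x', hx', h⟩ := (Proj.toSpecZero 𝒜).isClosedMap.specializingMap
    ((PrimeSpectrum.le_iff_specializes _ _).mp hq)
  exact ⟨x', (ProjectiveSpectrum.le_iff_mem_closure 𝒜 _ _).mpr
    (specializes_iff_mem_closure.mp hx'), h⟩

end GradedDomain


/-- Let `A` be a Noetherian domain of finite Krull dimension `k` and let `R` be
a finitely generated graded domain over `A` with `[R]₀ = A` and graded irrelevant ideal
`m = (R₊)`.  If `ht(m) ≥ 1` (equivalently, `m` is contained in no minimal prime of `R`),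
then there exists a chain of graded prime ideals `0 = P₀ ⊊ P₁ ⊊ ⋯ ⊊ P_k` of `R` such that
`P_k` does not contain `m`. -/
theorem stmt_3 {A R : Type*} [CommRing A] [IsDomain A] [IsNoetherianRing A]
    [CommRing R] [IsDomain R] [Algebra A R] [Algebra.FiniteType A R]
    (𝒜 : ℕ → Submodule A R) [GradedAlgebra 𝒜]
    (hinj : Function.Injective (algebraMap A R))
    (hzero : ∀ x : R, x ∈ 𝒜 0 ↔ ∃ a : A, algebraMap A R a = x)
    (k : ℕ) (hk : ringKrullDim A = k)
    (hht : ∀ P ∈ minimalPrimes R, ¬ (HomogeneousIdeal.irrelevant 𝒜).toIdeal ≤ P) :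
    ∃ P : Fin (k + 1) → Ideal R, StrictMono P ∧ P 0 = ⊥ ∧
      (∀ i, (P i).IsPrime ∧ (P i).IsHomogeneous 𝒜) ∧
      ¬ (HomogeneousIdeal.irrelevant 𝒜).toIdeal ≤ P (Fin.last k) := by
  let g : A →+* 𝒜 0 :=
    { toFun a := ⟨algebraMap A R a, (hzero _).mpr ⟨a, rfl⟩⟩
      map_one' := Subtype.ext (map_one _)
      map_mul' _ _ := Subtype.ext (map_mul _ _ _)
      map_zero' := Subtype.ext (map_zero _)
      map_add' _ _ := Subtype.ext (map_add _ _ _) }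
  have hg : Function.Bijective g := by
    refine ⟨fun a b hab ↦ hinj (congrArg Subtype.val hab), fun x ↦ ?_⟩
    obtain ⟨a, ha⟩ := (hzero _).mp x.2
    exact ⟨a, Subtype.ext ha⟩
  have hfin : Algebra.FiniteType (𝒜 0) R := by
    rw [← RingHom.finiteType_algebraMap]
    refine RingHom.FiniteType.of_comp_finiteType (f := g) ?_
    exact RingHom.finiteType_algebraMap.mpr ‹Algebra.FiniteType A R›
  have hirr : ¬ HomogeneousIdeal.irrelevant 𝒜 ≤ ⊥ := by
    have := hht ⊥ (by rw [IsDomain.minimalPrimes_eq_singleton_bot]; rfl)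
    rwa [← HomogeneousIdeal.toIdeal_bot (𝒜 := 𝒜)] at this
  rw [ringKrullDim_eq_of_ringEquiv (RingEquiv.ofBijective g hg)] at hk
  obtain ⟨l, hl⟩ := Order.le_krullDim_iff.mp hk.ge
  subst hl
  obtain ⟨p, hp, hp₀⟩ := exists_strictMono_lift
    (fun x : ProjectiveSpectrum 𝒜 ↦ (show PrimeSpectrum (𝒜 0) from Proj.toSpecZero 𝒜 x))
    (Proj.exists_le_toSpecZero_eq 𝒜) l.length l l.strictMono
    (ProjectiveSpectrum.genericPoint 𝒜 hirr)
    (by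
      rw [← PrimeSpectrum.asIdeal_le_asIdeal]
      exact (Proj.toSpecZero_genericPoint 𝒜 hirr).trans_le bot_le)
  refine ⟨fun i ↦ (p i).asHomogeneousIdeal.toIdeal, fun i j hij ↦ hp hij, ?_,
    fun i ↦ ⟨(p i).isPrime, (p i).asHomogeneousIdeal.isHomogeneous⟩,
    (p (Fin.last _)).not_irrelevant_le⟩
  exact (congrArg (fun x ↦ x.asHomogeneousIdeal.toIdeal) hp₀).trans HomogeneousIdeal.toIdeal_bot
end

section
/- Let A be a Noetherian domain of finite Krull dimension and R a finitely generated graded domain over A with [R]_0 = A and irrelevant ideal m of positive height. Then the dimension of the projective scheme X = Proj(R) satisfies dim(X) = dim(R) − 1. -/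
open DirectSum HomogeneousIdeal

section Graded

variable {R σ : Type*} [CommRing R] [SetLike σ R] [AddSubgroupClass σ R]
  (𝒜 : ℕ → σ) [GradedRing 𝒜]

/-- Pseudo-division with respect to a homogeneous prime `I`: if `f ∉ I` has the smallest possible
number of consecutive degrees supporting it modulo `I` among the elements of `J \ I`, then every
`g ∈ J` has a homogeneous multiple, by a factor outside `I`, in `I + (f)`. -/
theorem exists_isHomogeneousElem_mul_mem_sup_span {I J : Ideal R} (hI : I.IsHomogeneous 𝒜)
    (hIp : I.IsPrime) {f : R} (hfJ : f ∈ J) {k m : ℕ}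
    (hf : ∀ i, (decompose 𝒜 f i : R) ∉ I → k ≤ i ∧ i < k + (m + 1))
    (hmin : ∀ g ∈ J, g ∉ I → ∀ l n : ℕ,
      (∀ i, (decompose 𝒜 g i : R) ∉ I → l ≤ i ∧ i < l + n) → m < n)
    (hfI : f ∉ I) (n : ℕ) : ∀ g ∈ J, ∀ l : ℕ,
      (∀ i, (decompose 𝒜 g i : R) ∉ I → l ≤ i ∧ i < l + n) →
      ∃ s, SetLike.IsHomogeneousElem 𝒜 s ∧ s ∉ I ∧ s * g ∈ I ⊔ Ideal.span {f} := by
  induction n with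
  | zero =>
    intro g _ l hg
    refine ⟨1, ⟨0, SetLike.GradedOne.one_mem⟩, (Ideal.ne_top_iff_one _).1 hIp.ne_top, ?_⟩
    rw [one_mul]
    refine Ideal.mem_sup_left ((hI.mem_iff 𝒜).2 fun i => ?_)
    by_contra h
    have := hg i h
    omega
  | succ n ih =>
    intro g hgJ l hg
    by_cases hgI : g ∈ I
    · refine ⟨1, ⟨0, SetLike.GradedOne.one_mem⟩, (Ideal.ne_top_iff_one _).1 hIp.ne_top, ?_⟩
      rw [one_mul]
      exact Ideal.mem_sup_left hgI
    have hmn := hmin g hgJ hgI l _ hg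
    set a : R := (decompose 𝒜 f (k + m) : R) with ha
    set b : R := (decompose 𝒜 g (l + n) : R) with hb
    have ha_mem : a ∈ 𝒜 (k + m) := SetLike.coe_mem _
    have hb_mem : b ∈ 𝒜 (l + n) := SetLike.coe_mem _
    have haI : a ∉ I := by
      intro haI
      refine lt_irrefl m (hmin f hfJ hfI k m fun i hi => ?_)
      have h1 := hf i hi
      have h2 : i ≠ k + m := by rintro rfl; exact hi haI
      omega
    obtain ⟨s, hs, hsI, hsg⟩ := ih (a * g - b * f)
      (J.sub_mem (J.mul_mem_left _ hgJ) (J.mul_mem_left _ hfJ)) (k + m + l) (by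
        intro i hi
        by_contra hcon
        apply hi
        rw [decompose_sub, DirectSum.sub_apply, AddSubgroupClass.coe_sub,
          coe_decompose_mul_of_left_mem 𝒜 i ha_mem, coe_decompose_mul_of_left_mem 𝒜 i hb_mem]
        by_cases hi' : i = k + m + (l + n)
        · have e1 : i - (k + m) = l + n := by omega
          have e2 : i - (l + n) = k + m := by omega
          rw [if_pos (by omega), if_pos (by omega), e1, e2, ← ha, ← hb, mul_comm, sub_self]
          exact I.zero_mem
        refine I.sub_mem ?_ ?_
        · split_ifs with h
          · refine I.mul_mem_left _ ?_
            by_contra h'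
            have := hg _ h'
            omega
          · exact I.zero_mem
        · split_ifs with h
          · refine I.mul_mem_left _ ?_
            by_contra h'
            have := hf _ h'
            omega
          · exact I.zero_mem)
    refine ⟨s * a, hs.mul ⟨_, ha_mem⟩, fun h => (hIp.mem_or_mem h).elim hsI haI, ?_⟩
    have : s * a * g = s * (a * g - b * f) + s * b * f := by ring
    rw [this]
    exact Ideal.add_mem _ hsg
      (Ideal.mem_sup_right (Ideal.mul_mem_left _ _ (Ideal.mem_span_singleton_self f)))

namespace PrimeSpectrum

/-- The largest homogeneous prime contained in a prime. -/
def homogeneousCore (P : PrimeSpectrum R) : PrimeSpectrum R :=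
  ⟨(P.asIdeal.homogeneousCore 𝒜).toIdeal, P.2.homogeneousCore⟩

theorem homogeneousCore_isHomogeneous (P : PrimeSpectrum R) :
    (P.homogeneousCore 𝒜).asIdeal.IsHomogeneous 𝒜 :=
  HomogeneousIdeal.isHomogeneous _

theorem homogeneousCore_le (P : PrimeSpectrum R) : P.homogeneousCore 𝒜 ≤ P :=
  Ideal.toIdeal_homogeneousCore_le 𝒜 _

theorem le_homogeneousCore {P Q : PrimeSpectrum R} (hQ : Q.asIdeal.IsHomogeneous 𝒜)
    (h : Q ≤ P) : Q ≤ P.homogeneousCore 𝒜 := by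
  change Q.asIdeal ≤ (P.asIdeal.homogeneousCore 𝒜).toIdeal
  rw [← hQ.toIdeal_homogeneousCore_eq_self]
  exact Ideal.homogeneousCore_mono 𝒜 h

/-- For a prime `P`, the prime `P₀ ⊕ R₊`, i.e. the elements whose constant term is in `P`. -/
def addIrrelevant (P : PrimeSpectrum R) : PrimeSpectrum R :=
  P.comap (GradedRing.projZeroRingHom 𝒜)

theorem mem_addIrrelevant {P : PrimeSpectrum R} {x : R} :
    x ∈ (P.addIrrelevant 𝒜).asIdeal ↔ (decompose 𝒜 x 0 : R) ∈ P.asIdeal :=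
  Iff.rfl

theorem irrelevant_le_addIrrelevant (P : PrimeSpectrum R) :
    (irrelevant 𝒜).toIdeal ≤ (P.addIrrelevant 𝒜).asIdeal := by
  intro x hx
  have hx' : (decompose 𝒜 x 0 : R) = 0 := hx
  rw [mem_addIrrelevant, hx']
  exact P.asIdeal.zero_mem

theorem le_addIrrelevant {P : PrimeSpectrum R} (hP : P.asIdeal.IsHomogeneous 𝒜) :
    P ≤ P.addIrrelevant 𝒜 :=
  fun _ hx => hP 0 hx

theorem addIrrelevant_mono {P Q : PrimeSpectrum R} (h : P ≤ Q) :
    P.addIrrelevant 𝒜 ≤ Q.addIrrelevant 𝒜 :=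
  fun _ hx => h hx

theorem addIrrelevant_le {P : PrimeSpectrum R} (hP : (irrelevant 𝒜).toIdeal ≤ P.asIdeal) :
    P.addIrrelevant 𝒜 ≤ P := by
  intro x hx
  have h1 : x - decompose 𝒜 x 0 ∈ (irrelevant 𝒜).toIdeal := by
    change (decompose 𝒜 (x - decompose 𝒜 x 0) 0 : R) = 0
    simp
  have := P.asIdeal.add_mem (hP h1) hx
  rwa [GradedRing.projZeroRingHom_apply, sub_add_cancel] at this

theorem isHomogeneous_of_irrelevant_le {P : PrimeSpectrum R}
    (hP : (irrelevant 𝒜).toIdeal ≤ P.asIdeal) : P.asIdeal.IsHomogeneous 𝒜 := by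
  intro i x hx
  rcases Nat.eq_zero_or_pos i with rfl | hi
  · have h1 : x - decompose 𝒜 x 0 ∈ (irrelevant 𝒜).toIdeal := by
      change (decompose 𝒜 (x - decompose 𝒜 x 0) 0 : R) = 0
      simp
    have := P.asIdeal.sub_mem hx (hP h1)
    rwa [sub_sub_cancel] at this
  · exact hP (mem_irrelevant_of_mem 𝒜 hi (SetLike.coe_mem _))

section Noetherian

variable [IsNoetherianRing R]

/-- There is no prime strictly between a prime and its homogeneous core. -/
theorem not_lt_of_homogeneousCore_lt {P Q : PrimeSpectrum R} (h : P.homogeneousCore 𝒜 < Q) :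
    ¬ Q < P := by
  intro hQP
  set I := P.homogeneousCore 𝒜
  have hI : I.asIdeal.IsHomogeneous 𝒜 := P.homogeneousCore_isHomogeneous 𝒜
  have hbound : ∀ g : R, ∃ n : ℕ, ∀ i, (decompose 𝒜 g i : R) ∉ I.asIdeal → 0 ≤ i ∧ i < 0 + n := by
    classical
    intro g
    refine ⟨(decompose 𝒜 g).support.sup id + 1, fun i hi => ⟨i.zero_le, ?_⟩⟩
    have : i ∈ (decompose 𝒜 g).support := by
      rw [DFinsupp.mem_support_iff]
      intro h0
      rw [h0] at hi
      exact hi I.asIdeal.zero_mem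
    have : i ≤ (decompose 𝒜 g).support.sup id := Finset.le_sup (f := id) this
    omega
  have hex : ∃ n : ℕ, ∃ f ∈ P.asIdeal, f ∉ I.asIdeal ∧ ∃ k : ℕ,
      ∀ i, (decompose 𝒜 f i : R) ∉ I.asIdeal → k ≤ i ∧ i < k + n := by
    obtain ⟨f, hfP, hfI⟩ := SetLike.exists_of_lt ((asIdeal_lt_asIdeal _ _).2 (h.trans hQP))
    obtain ⟨n, hn⟩ := hbound f
    exact ⟨n, f, hfP, hfI, 0, hn⟩
  classical
  obtain ⟨f, hfP, hfI, k, hk⟩ := Nat.find_spec hex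
  have hmin := fun n => Nat.find_min' hex (m := n)
  generalize Nat.find hex = N at hk hmin
  obtain _ | m := N
  · refine hfI ((hI.mem_iff 𝒜).2 fun i => ?_)
    by_contra hi
    have := hk i hi
    omega
  obtain ⟨q, hfq, hIq, hqP⟩ := exist_mem_one_of_mem_two h hQP hfP
  refine hqP.not_ge fun g hg => ?_
  obtain ⟨n, hn⟩ := hbound g
  obtain ⟨s, hs, hsI, hsg⟩ := exists_isHomogeneousElem_mul_mem_sup_span 𝒜 hI I.2 hfP hk
    (fun g hg hgI l n hn => hmin n ⟨g, hg, hgI, l, hn⟩) hfI n g hg 0 hn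
  have hsgq : s * g ∈ q.asIdeal :=
    (sup_le hIq.le ((Ideal.span_singleton_le_iff_mem _).2 hfq)) hsg
  refine (q.2.mem_or_mem hsgq).resolve_left fun hsq => hsI ?_
  exact Ideal.mem_homogeneousCore_of_homogeneous_of_mem hs (hqP.le hsq)

/-- If there is a prime strictly between two homogeneous primes, there is a homogeneous one. -/
theorem exists_isHomogeneous_between {P Q S : PrimeSpectrum R} (hP : P.asIdeal.IsHomogeneous 𝒜)
    (hS : S.asIdeal.IsHomogeneous 𝒜) (hPQ : P < Q) (hQS : Q < S) :
    ∃ T : PrimeSpectrum R, T.asIdeal.IsHomogeneous 𝒜 ∧ P < T ∧ T < S := by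
  obtain ⟨x, hxS, hxP⟩ := SetLike.exists_of_lt ((asIdeal_lt_asIdeal _ _).2 (hPQ.trans hQS))
  obtain ⟨i, hi⟩ : ∃ i, (decompose 𝒜 x i : R) ∉ P.asIdeal := by
    by_contra! h
    exact hxP ((hP.mem_iff 𝒜).2 h)
  obtain ⟨q, hxq, hPq, hqS⟩ := exist_mem_one_of_mem_two hPQ hQS (hS i hxS)
  refine ⟨q.homogeneousCore 𝒜, q.homogeneousCore_isHomogeneous 𝒜, ?_,
    (q.homogeneousCore_le 𝒜).trans_lt hqS⟩
  refine (le_homogeneousCore 𝒜 hP hPq.le).lt_of_not_ge fun h => hi (h ?_)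
  exact Ideal.mem_homogeneousCore_of_homogeneous_of_mem ⟨i, SetLike.coe_mem _⟩ hxq

/-- If there is a prime strictly between a relevant homogeneous prime and a homogeneous prime, then
there is a relevant homogeneous one. -/
theorem exists_relevant_between {P Q S : PrimeSpectrum R} (hP : P.asIdeal.IsHomogeneous 𝒜)
    (hPr : ¬ (irrelevant 𝒜).toIdeal ≤ P.asIdeal) (hS : S.asIdeal.IsHomogeneous 𝒜)
    (hPQ : P < Q) (hQS : Q < S) :
    ∃ T : PrimeSpectrum R, T.asIdeal.IsHomogeneous 𝒜 ∧
      ¬ (irrelevant 𝒜).toIdeal ≤ T.asIdeal ∧ P < T ∧ T < S := by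
  obtain ⟨T, hT, hPT, hTS⟩ := exists_isHomogeneous_between 𝒜 hP hS hPQ hQS
  by_cases hTr : (irrelevant 𝒜).toIdeal ≤ T.asIdeal
  swap
  · exact ⟨T, hT, hTr, hPT, hTS⟩
  have hM : P.addIrrelevant 𝒜 < S :=
    ((addIrrelevant_mono 𝒜 hPT.le).trans (addIrrelevant_le 𝒜 hTr)).trans_lt hTS
  obtain ⟨r, hrS, hrM⟩ := SetLike.exists_of_lt ((asIdeal_lt_asIdeal _ _).2 hM)
  rw [mem_addIrrelevant] at hrM
  set a : R := (decompose 𝒜 r 0 : R)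
  have haS : a ∈ S.asIdeal := hS 0 hrS
  have ha0 : a ∈ 𝒜 0 := SetLike.coe_mem _
  have hle : P.asIdeal ⊔ Ideal.span {a} ≤ S.asIdeal :=
    sup_le ((le_addIrrelevant 𝒜 hP).trans hM.le) ((Ideal.span_singleton_le_iff_mem _).2 haS)
  obtain ⟨q, hq, hqS⟩ := Ideal.exists_minimalPrimes_le hle
  set q' : PrimeSpectrum R := ⟨q, hq.1.1⟩
  have haq : a ∈ q'.asIdeal := hq.1.2 (Ideal.mem_sup_right (Ideal.mem_span_singleton_self a))
  have hPq : P < q' := lt_of_le_of_ne (le_sup_left.trans hq.1.2) fun h => hrM (h ▸ haq)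
  have hmin : ∀ t : PrimeSpectrum R, P ≤ t → a ∈ t.asIdeal → t ≤ q' → q' ≤ t := fun t hPt hat htq =>
    hq.2 ⟨t.2, sup_le hPt ((Ideal.span_singleton_le_iff_mem _).2 hat)⟩ htq
  have hqr : ¬ (irrelevant 𝒜).toIdeal ≤ q'.asIdeal := by
    intro hqr
    have h1 : P < P.addIrrelevant 𝒜 := lt_of_le_of_ne (le_addIrrelevant 𝒜 hP) fun h =>
      hPr (h ▸ irrelevant_le_addIrrelevant 𝒜 P)
    have h2 : P.addIrrelevant 𝒜 < q' := by
      refine lt_of_le_of_ne ((addIrrelevant_mono 𝒜 hPq.le).trans (addIrrelevant_le 𝒜 hqr)) ?_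
      intro h
      rw [← h, mem_addIrrelevant, decompose_of_mem_same 𝒜 ha0] at haq
      exact hrM haq
    obtain ⟨t, hat, hPt, htq⟩ := exist_mem_one_of_mem_two h1 h2 haq
    exact htq.not_ge (hmin t hPt.le hat htq.le)
  refine ⟨q', ?_, hqr, hPq, lt_of_le_of_ne hqS fun h => hqr ?_⟩
  · have h := hmin (q'.homogeneousCore 𝒜) (le_homogeneousCore 𝒜 hP hPq.le)
      (Ideal.mem_homogeneousCore_of_homogeneous_of_mem ⟨0, ha0⟩ haq) (q'.homogeneousCore_le 𝒜)
    rw [le_antisymm h (q'.homogeneousCore_le 𝒜)]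
    exact q'.homogeneousCore_isHomogeneous 𝒜
  · rw [h]
    exact hTr.trans hTS.le

end Noetherian

end PrimeSpectrum

namespace ProjectiveSpectrum

/-- The prime underlying a point of the projective spectrum. -/
def toPrimeSpectrum (x : ProjectiveSpectrum 𝒜) : PrimeSpectrum R :=
  ⟨x.asHomogeneousIdeal.toIdeal, x.isPrime⟩

variable {𝒜}

theorem toPrimeSpectrum_isHomogeneous (x : ProjectiveSpectrum 𝒜) :
    (x.toPrimeSpectrum 𝒜).asIdeal.IsHomogeneous 𝒜 :=
  HomogeneousIdeal.isHomogeneous _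

theorem toPrimeSpectrum_not_irrelevant_le (x : ProjectiveSpectrum 𝒜) :
    ¬ (irrelevant 𝒜).toIdeal ≤ (x.toPrimeSpectrum 𝒜).asIdeal :=
  x.not_irrelevant_le

theorem toPrimeSpectrum_strictMono :
    StrictMono (toPrimeSpectrum 𝒜) :=
  fun _ _ h => h

theorem exists_toPrimeSpectrum_eq {P : PrimeSpectrum R} (hP : P.asIdeal.IsHomogeneous 𝒜)
    (hPr : ¬ (irrelevant 𝒜).toIdeal ≤ P.asIdeal) :
    ∃ x : ProjectiveSpectrum 𝒜, x.toPrimeSpectrum 𝒜 = P :=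
  ⟨⟨⟨P.asIdeal, hP⟩, P.2, hPr⟩, rfl⟩

instance : QuasiSober (ProjectiveSpectrum 𝒜) :=
  inferInstanceAs (QuasiSober (AlgebraicGeometry.Proj 𝒜))

instance : T0Space (ProjectiveSpectrum 𝒜) :=
  inferInstanceAs (T0Space (AlgebraicGeometry.Proj 𝒜))

theorem topologicalKrullDim_eq_krullDim :
    topologicalKrullDim (ProjectiveSpectrum 𝒜) = Order.krullDim (ProjectiveSpectrum 𝒜) := by
  rw [← Order.krullDim_orderDual (α := ProjectiveSpectrum 𝒜), topologicalKrullDim]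
  let e : ProjectiveSpectrum 𝒜 ≃o (TopologicalSpace.IrreducibleCloseds (ProjectiveSpectrum 𝒜))ᵒᵈ :=
    { (irreducibleSetEquivPoints.toEquiv.symm.trans OrderDual.toDual) with
      map_rel_iff' := by
        intro x y
        change closure {y} ⊆ closure {x} ↔ x ≤ y
        rw [le_iff_mem_closure, isClosed_closure.closure_subset_iff, Set.singleton_subset_iff] }
  exact (Order.krullDim_eq_of_orderIso e.dual).symm

/-- If the irrelevant ideal lies in no minimal prime, every prime contains a relevant homogeneous
one. -/
theorem exists_toPrimeSpectrum_le
    (h : ∀ P ∈ minimalPrimes R, ¬ (irrelevant 𝒜).toIdeal ≤ P) (P : PrimeSpectrum R) :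
    ∃ x : ProjectiveSpectrum 𝒜, x.toPrimeSpectrum 𝒜 ≤ P := by
  obtain ⟨p, hp, hpP⟩ := Ideal.exists_minimalPrimes_le (bot_le (a := P.asIdeal))
  have hcore := hp.2 ⟨hp.1.1.homogeneousCore (𝒜 := 𝒜), bot_le⟩
    (Ideal.toIdeal_homogeneousCore_le 𝒜 p)
  exact ⟨⟨p.homogeneousCore 𝒜, hp.1.1.homogeneousCore, fun hirr =>
    h p hp (le_trans hirr (Ideal.toIdeal_homogeneousCore_le 𝒜 p))⟩,
    (Ideal.toIdeal_homogeneousCore_le 𝒜 p).trans hpP⟩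

theorem height_add_one_le_of_lt {x : ProjectiveSpectrum 𝒜} {P : PrimeSpectrum R}
    (hP : P.asIdeal.IsHomogeneous 𝒜) (hPr : ¬ (irrelevant 𝒜).toIdeal ≤ P.asIdeal)
    (h : x.toPrimeSpectrum 𝒜 < P) :
    ∃ y : ProjectiveSpectrum 𝒜, y.toPrimeSpectrum 𝒜 = P ∧ Order.height x + 1 ≤ Order.height y := by
  obtain ⟨y, rfl⟩ := exists_toPrimeSpectrum_eq hP hPr
  exact ⟨y, rfl, Order.height_add_one_le h⟩

/-- Heights in the projective spectrum: relevant homogeneous primes have the same height in the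
projective spectrum as in the prime spectrum, and any other prime contains a relevant homogeneous
prime whose height is smaller by at most one. -/
theorem le_height_of_le_height [IsNoetherianRing R]
    (h : ∀ P ∈ minimalPrimes R, ¬ (irrelevant 𝒜).toIdeal ≤ P) (n : ℕ) :
    (∀ x : ProjectiveSpectrum 𝒜, n ≤ Order.height (x.toPrimeSpectrum 𝒜) → n ≤ Order.height x) ∧
    ∀ P : PrimeSpectrum R, n ≤ Order.height P →
      ∃ x : ProjectiveSpectrum 𝒜, x.toPrimeSpectrum 𝒜 ≤ P ∧ n ≤ Order.height x + 1 := by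
  induction n with
  | zero =>
    refine ⟨by simp, fun P _ => ?_⟩
    obtain ⟨x, hx⟩ := exists_toPrimeSpectrum_le h P
    exact ⟨x, hx, by simp⟩
  | succ n ih =>
    have hlt : ∀ P : PrimeSpectrum R, (n + 1 : ℕ) ≤ Order.height P →
        ∃ Q < P, n ≤ Order.height Q := by
      intro P hP
      obtain ⟨p, rfl, hp⟩ := Order.exists_series_of_le_height P hP
      refine ⟨p.eraseLast.last, p.eraseLast_last_rel_last (by omega), ?_⟩
      have := Order.length_le_height_last (p := p.eraseLast)
      rwa [RelSeries.eraseLast_length, hp, Nat.add_sub_cancel] at this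
    have key : ∀ x : ProjectiveSpectrum 𝒜, (n + 1 : ℕ) ≤ Order.height (x.toPrimeSpectrum 𝒜) →
        (n + 1 : ℕ) ≤ Order.height x := by
      intro x hx
      obtain ⟨Q, hQx, hQ⟩ := hlt _ hx
      by_cases hQh : Q.asIdeal.IsHomogeneous 𝒜
      · obtain ⟨y, rfl⟩ := exists_toPrimeSpectrum_eq hQh
          fun hr => x.toPrimeSpectrum_not_irrelevant_le (hr.trans hQx.le)
        push_cast
        exact (add_le_add_left (ih.1 y hQ) 1).trans (Order.height_add_one_le hQx)
      · obtain ⟨y, hyQ, hy⟩ := ih.2 Q hQ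
        have hyQ' : y.toPrimeSpectrum 𝒜 < Q := lt_of_le_of_ne hyQ fun he =>
          hQh (he ▸ y.toPrimeSpectrum_isHomogeneous)
        obtain ⟨T, hT, hTr, hyT, hTx⟩ := PrimeSpectrum.exists_relevant_between 𝒜
          y.toPrimeSpectrum_isHomogeneous y.toPrimeSpectrum_not_irrelevant_le
          x.toPrimeSpectrum_isHomogeneous hyQ' hQx
        obtain ⟨z, rfl, hz⟩ := height_add_one_le_of_lt hT hTr hyT
        push_cast
        exact (add_le_add_left (hy.trans hz) 1).trans (Order.height_add_one_le hTx)
    refine ⟨key, fun P hP => ?_⟩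
    by_cases hPh : P.asIdeal.IsHomogeneous 𝒜 ∧ ¬ (irrelevant 𝒜).toIdeal ≤ P.asIdeal
    · obtain ⟨x, rfl⟩ := exists_toPrimeSpectrum_eq hPh.1 hPh.2
      exact ⟨x, le_rfl, (key x hP).trans le_self_add⟩
    obtain ⟨Q, hQP, hQ⟩ := hlt _ hP
    by_cases hQh : Q.asIdeal.IsHomogeneous 𝒜 ∧ ¬ (irrelevant 𝒜).toIdeal ≤ Q.asIdeal
    · obtain ⟨x, rfl⟩ := exists_toPrimeSpectrum_eq hQh.1 hQh.2
      refine ⟨x, hQP.le, ?_⟩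
      push_cast
      exact add_le_add_left (ih.1 x hQ) 1
    obtain ⟨y, hyQ, hy⟩ := ih.2 Q hQ
    have hyQ' : y.toPrimeSpectrum 𝒜 < Q := by
      refine lt_of_le_of_ne hyQ ?_
      rintro rfl
      exact hQh ⟨y.toPrimeSpectrum_isHomogeneous, y.toPrimeSpectrum_not_irrelevant_le⟩
    obtain ⟨T, hT, hTr, hyT, hTP⟩ : ∃ T : PrimeSpectrum R, T.asIdeal.IsHomogeneous 𝒜 ∧
        ¬ (irrelevant 𝒜).toIdeal ≤ T.asIdeal ∧ y.toPrimeSpectrum 𝒜 < T ∧ T ≤ P := by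
      by_cases hPr : (irrelevant 𝒜).toIdeal ≤ P.asIdeal
      · obtain ⟨T, hT, hTr, hyT, hTP⟩ := PrimeSpectrum.exists_relevant_between 𝒜
          y.toPrimeSpectrum_isHomogeneous y.toPrimeSpectrum_not_irrelevant_le
          (PrimeSpectrum.isHomogeneous_of_irrelevant_le 𝒜 hPr) hyQ' hQP
        exact ⟨T, hT, hTr, hyT, hTP.le⟩
      · refine ⟨P.homogeneousCore 𝒜, P.homogeneousCore_isHomogeneous 𝒜, fun hr =>
          hPr (hr.trans (P.homogeneousCore_le 𝒜)), lt_of_le_of_ne (PrimeSpectrum.le_homogeneousCore 𝒜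
            y.toPrimeSpectrum_isHomogeneous (hyQ.trans hQP.le)) fun he => ?_,
          P.homogeneousCore_le 𝒜⟩
        exact PrimeSpectrum.not_lt_of_homogeneousCore_lt 𝒜 (he ▸ hyQ') hQP
    obtain ⟨z, rfl, hz⟩ := height_add_one_le_of_lt hT hTr hyT
    refine ⟨z, hTP, ?_⟩
    push_cast
    exact add_le_add_left (hy.trans hz) 1

/-- If `R` is a Noetherian graded ring whose irrelevant ideal lies in no minimal prime, then
`dim R = dim (Proj R) + 1`. -/
theorem ringKrullDim_eq_topologicalKrullDim_add_one [Nontrivial R] [IsNoetherianRing R]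
    (h : ∀ P ∈ minimalPrimes R, ¬ (irrelevant 𝒜).toIdeal ≤ P) :
    ringKrullDim R = topologicalKrullDim (ProjectiveSpectrum 𝒜) + (1 : WithBot ℕ∞) := by
  rw [topologicalKrullDim_eq_krullDim, ringKrullDim]
  obtain ⟨P⟩ := (inferInstance : Nonempty (PrimeSpectrum R))
  have : Nonempty (ProjectiveSpectrum 𝒜) := ⟨(exists_toPrimeSpectrum_le h P).choose⟩
  rw [Order.krullDim_eq_iSup_height_of_nonempty, Order.krullDim_eq_iSup_height_of_nonempty,
    ← WithBot.coe_one, ← WithBot.coe_add, WithBot.coe_inj, ENat.iSup_add]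
  refine le_antisymm (iSup_le fun P => ?_) (iSup_le fun x => ?_)
  · refine ENat.forall_natCast_le_iff_le.1 fun n hn => ?_
    obtain ⟨x, -, hx⟩ := (le_height_of_le_height h n).2 P hn
    exact hx.trans (le_iSup (fun x : ProjectiveSpectrum 𝒜 => Order.height x + 1) x)
  · have hlt : x.toPrimeSpectrum 𝒜 < (x.toPrimeSpectrum 𝒜).addIrrelevant 𝒜 :=
      lt_of_le_of_ne (PrimeSpectrum.le_addIrrelevant 𝒜 x.toPrimeSpectrum_isHomogeneous) fun he =>
        x.toPrimeSpectrum_not_irrelevant_le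
          (he ▸ PrimeSpectrum.irrelevant_le_addIrrelevant 𝒜 (x.toPrimeSpectrum 𝒜))
    exact (add_le_add_left (Order.height_le_height_apply_of_strictMono _
      toPrimeSpectrum_strictMono x) 1).trans ((Order.height_add_one_le hlt).trans
        (le_iSup (fun P : PrimeSpectrum R => Order.height P) _))

end ProjectiveSpectrum

end Graded


/-- Let `A` be a Noetherian domain of finite Krull dimension and `R` a
finitely generated graded domain over `A` with `[R]₀ = A` and irrelevant ideal `m` of
positive height (i.e. `m` lies in no minimal prime of `R`).  Then the dimension of the
projective scheme `X = Proj R` satisfies `dim X = dim R − 1`, stated here as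
`dim R = dim X + 1`. -/
theorem stmt_4 {A R : Type*} [CommRing A] [IsDomain A] [IsNoetherianRing A]
    [CommRing R] [IsDomain R] [Algebra A R] [Algebra.FiniteType A R]
    (𝒜 : ℕ → Submodule A R) [GradedAlgebra 𝒜]
    (hinj : Function.Injective (algebraMap A R))
    (hzero : ∀ x : R, x ∈ 𝒜 0 ↔ ∃ a : A, algebraMap A R a = x)
    (hdim : ringKrullDim A ≠ ⊤)
    (hht : ∀ P ∈ minimalPrimes R, ¬ (HomogeneousIdeal.irrelevant 𝒜).toIdeal ≤ P) :
    ringKrullDim R = topologicalKrullDim (ProjectiveSpectrum 𝒜) + (1 : WithBot ℕ∞) := by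
  have : IsNoetherianRing R := Algebra.FiniteType.isNoetherianRing A R
  exact ProjectiveSpectrum.ringKrullDim_eq_topologicalKrullDim_add_one hht
end

section
/- Let R be a Noetherian ring, I = (f_1, …, f_m) an ideal of R, and S = R[z_{i,j} : 1 ≤ i ≤ n, 1 ≤ j ≤ m] a polynomial ring over R in nm variables. Let J = (p_1, …, p_n) ⊆ S where p_i = f_1 z_{i,1} + f_2 z_{i,2} + ⋯ + f_m z_{i,m}. Then grade(J) ≥ min{n, grade(I)}. -/
/-- The grade of an ideal `I` in a commutative ring `R`: the supremum of the lengths of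
regular sequences (on `R`) consisting of elements of `I`. -/
noncomputable def ringGrade {R : Type*} [CommRing R] (I : Ideal R) : ℕ :=
  sSup {n : ℕ | ∃ rs : List R, rs.length = n ∧ (∀ r ∈ rs, r ∈ I) ∧
    RingTheory.Sequence.IsRegular R rs}

namespace Polynomial

/-- If a linear polynomial `c X + q` multiplies `u` into an extended ideal, then so does a
power of its leading coefficient `c`. -/
lemma exists_C_pow_mul_mem_map_C {B : Type*} [CommRing B] (K : Ideal B) (c q : B)
    (u : Polynomial B) (h : (C c * X + C q) * u ∈ K.map (C : B →+* Polynomial B)) :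
    ∃ N : ℕ, C (c ^ N) * u ∈ K.map (C : B →+* Polynomial B) := by
  rw [Ideal.mem_map_C_iff] at h
  have key : ∀ i d : ℕ, u.natDegree < d + i → c ^ i * u.coeff d ∈ K := by
    intro i
    induction i with
    | zero =>
      intro d hd
      simp [coeff_eq_zero_of_natDegree_lt (p := u) (n := d) (by simpa using hd)]
    | succ i ih =>
      intro d hd
      have h1 := h (d + 1)
      rw [add_mul, coeff_add, mul_assoc, coeff_C_mul, coeff_X_mul, coeff_C_mul] at h1
      have h2 := ih (d + 1) (by lia)
      have h3 := K.sub_mem (K.mul_mem_left (c ^ i) h1) (K.mul_mem_left q h2)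
      convert h3 using 1
      ring
  refine ⟨u.natDegree + 1, Ideal.mem_map_C_iff.mpr fun d => ?_⟩
  rw [coeff_C_mul]
  exact key _ _ (by lia)

end Polynomial

namespace MvPolynomial

variable {R σ : Type*} [CommRing R]

lemma exists_C_pow_mul_mem_span_of_supported (v : σ) (T : Set (MvPolynomial σ R))
    (hT : ∀ t ∈ T, t ∈ supported R ({v}ᶜ : Set σ)) (c : R) (q : MvPolynomial σ R)
    (hq : q ∈ supported R ({v}ᶜ : Set σ)) (u : MvPolynomial σ R)
    (h : (C c * X v + q) * u ∈ Ideal.span T) :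
    ∃ N : ℕ, C (c ^ N) * u ∈ Ideal.span T := by
  classical
  obtain ⟨e, heX, heC, heX'⟩ :
      ∃ e : MvPolynomial σ R ≃+* Polynomial (MvPolynomial {b // b ≠ v} R),
      e (X v) = Polynomial.X ∧ (∀ r, e (C r) = Polynomial.C (C r)) ∧
        ∀ w (hw : w ≠ v), e (X w) = Polynomial.C (X ⟨w, hw⟩) :=
    ⟨((renameEquiv R (Equiv.optionSubtypeNe v).symm).trans
      (optionEquivLeft R {b // b ≠ v})).toRingEquiv, by simp, by simp, fun w hw => by
        simp [Equiv.optionSubtypeNe_symm_of_ne hw]⟩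
  have he (t : MvPolynomial σ R) (ht : t ∈ supported R ({v}ᶜ : Set σ)) :
      ∃ b, Polynomial.C b = e t := by
    rw [supported_eq_adjoin_X] at ht
    induction ht using Algebra.adjoin_induction with
    | mem x hx =>
      obtain ⟨w, hw, rfl⟩ := hx
      exact ⟨X ⟨w, hw⟩, (heX' w hw).symm⟩
    | algebraMap r => exact ⟨C r, (heC r).symm⟩
    | add x y _ _ hx hy =>
      obtain ⟨a, ha⟩ := hx
      obtain ⟨b, hb⟩ := hy
      exact ⟨a + b, by simp [ha, hb]⟩
    | mul x y _ _ hx hy =>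
      obtain ⟨a, ha⟩ := hx
      obtain ⟨b, hb⟩ := hy
      exact ⟨a * b, by simp [ha, hb]⟩
  let K : Ideal (MvPolynomial {b // b ≠ v} R) := Ideal.span (Polynomial.C ⁻¹' (e '' T))
  have hK : K.map Polynomial.C = (Ideal.span T).map e := by
    rw [Ideal.map_span, Ideal.map_span, Set.image_preimage_eq_of_subset]
    rintro _ ⟨t, ht, rfl⟩
    exact he t (hT t ht)
  have hmem (x : MvPolynomial σ R) : e x ∈ K.map Polynomial.C ↔ x ∈ Ideal.span T := by
    rw [hK]
    exact (Ideal.mem_map_of_equiv e _).trans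
      ⟨by rintro ⟨y, hy, hyx⟩; exact e.injective hyx ▸ hy, fun hx => ⟨x, hx, rfl⟩⟩
  obtain ⟨b, hb⟩ := he q hq
  obtain ⟨N, hN⟩ := Polynomial.exists_C_pow_mul_mem_map_C K (C c) b (e u) (by
    rw [← hmem] at h
    simpa [heX, heC, hb] using h)
  refine ⟨N, (hmem _).mp ?_⟩
  simpa [heC] using hN

/-- A generic linear combination of `f` is regular modulo an ideal not involving its
variables, as soon as `Ideal.span (Set.range f)` contains an element regular modulo that ideal. -/
lemma mem_span_of_linear_form_mul_mem {m : ℕ} (z : Fin m → σ) (hz : Function.Injective z)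
    (f : Fin m → R) (T : Set (MvPolynomial σ R))
    (hT : ∀ t ∈ T, t ∈ supported R ((Set.range z)ᶜ : Set σ))
    (a : R) (ha : a ∈ Ideal.span (Set.range f))
    (hreg : ∀ u, C a * u ∈ Ideal.span T → u ∈ Ideal.span T)
    (u : MvPolynomial σ R) (h : (∑ j, C (f j) * X (z j)) * u ∈ Ideal.span T) :
    u ∈ Ideal.span T := by
  classical
  nontriviality R
  let Q : Ideal R :=
    Ideal.comap C (Submodule.comap (LinearMap.mulRight (MvPolynomial σ R) u) (Ideal.span T))
  have hQ (r : R) : r ∈ Q ↔ C r * u ∈ Ideal.span T := Iff.rfl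
  have hle : Ideal.span (Set.range f) ≤ Q.radical := by
    rw [Ideal.span_le]
    rintro _ ⟨j, rfl⟩
    obtain ⟨N, hN⟩ := exists_C_pow_mul_mem_span_of_supported (z j) T
      (fun t ht => supported_mono (by simp) (hT t ht)) (f j)
      (∑ i ∈ Finset.univ.erase j, C (f i) * X (z i))
      (Subalgebra.sum_mem _ fun i hi => Subalgebra.mul_mem _ (Subalgebra.algebraMap_mem _ _)
        (X_mem_supported.mpr (by simpa [hz.eq_iff] using hi))) u
      (by rwa [Finset.add_sum_erase _ (fun i => C (f i) * X (z i)) (Finset.mem_univ j)])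
    exact ⟨N, (hQ _).mpr hN⟩
  obtain ⟨N, hN⟩ := hle ha
  rw [hQ] at hN
  induction N with
  | zero => simpa using hN
  | succ N ih =>
    refine ih (hreg _ ?_)
    rwa [← mul_assoc, ← C_mul, ← pow_succ']

end MvPolynomial

namespace RingTheory.Sequence

open Ideal

variable {T : Type*} [CommRing T]

lemma isWeaklyRegular_self_iff (l : List T) : IsWeaklyRegular T l ↔
    ∀ i (h : i < l.length), ∀ u, l[i] * u ∈ ofList (l.take i) → u ∈ ofList (l.take i) := by
  simp only [isWeaklyRegular_iff, isSMulRegular_quotient_iff_mem_of_smul_mem, smul_eq_mul,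
    Ideal.mul_top]

lemma _root_.Ideal.ofList_take_succ (l : List T) (i : ℕ) (h : i < l.length) :
    ofList (l.take (i + 1)) = ofList (l.take i) ⊔ span {l[i]} := by
  rw [List.take_succ_eq_append_getElem h, ofList_append, ofList_singleton]

/-- Exchanging a weakly regular sequence `as` for a sequence `ps` whose `k`-th member is regular
modulo the first `k` members of `ps` and the first `i` members of `as` whenever `as[i]` is. -/
lemma IsWeaklyRegular.exchange {as ps : List T} (has : IsWeaklyRegular T as)
    (H : ∀ k (hk : k < ps.length) i (hi : i < as.length),
      (∀ u, as[i] * u ∈ ofList (ps.take k) ⊔ ofList (as.take i) →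
        u ∈ ofList (ps.take k) ⊔ ofList (as.take i)) →
      ∀ u, ps[k] * u ∈ ofList (ps.take k) ⊔ ofList (as.take i) →
        u ∈ ofList (ps.take k) ⊔ ofList (as.take i)) :
    IsWeaklyRegular T (ps.take as.length) := by
  rw [isWeaklyRegular_self_iff] at has
  have key : ∀ k ≤ ps.length, ∀ i (hi : i + k < as.length), ∀ u,
      as[i] * u ∈ ofList (ps.take k) ⊔ ofList (as.take i) →
        u ∈ ofList (ps.take k) ⊔ ofList (as.take i) := by
    intro k
    induction k with
    | zero => intro _ i hi; simpa using has i hi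
    | succ k ih =>
      intro hk i hi u hu
      have ih := ih (by lia)
      have hp := fun i hi => H k hk i (by lia) (ih i hi)
      rw [ofList_take_succ ps k hk, sup_right_comm] at hu ⊢
      obtain ⟨w, hw, y, hy, hwy⟩ := Submodule.mem_sup.mp hu
      obtain ⟨t, rfl⟩ := mem_span_singleton'.mp hy
      have ht : t ∈ ofList (ps.take k) ⊔ ofList (as.take (i + 1)) := by
        refine hp (i + 1) (by lia) t ?_
        rw [ofList_take_succ as i (by lia), ← sup_assoc]
        rw [show ps[k] * t = as[i] * u - w by rw [← hwy]; ring]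
        exact sub_mem (mul_mem_right _ _ (mem_sup_right (mem_span_singleton_self _)))
          (mem_sup_left hw)
      rw [ofList_take_succ as i (by lia), ← sup_assoc] at ht
      obtain ⟨w', hw', y', hy', hwy'⟩ := Submodule.mem_sup.mp ht
      obtain ⟨s, rfl⟩ := mem_span_singleton'.mp hy'
      have hs := ih i (by lia) (u - ps[k] * s) (by
        rw [show as[i] * (u - ps[k] * s) = w + ps[k] * w' by
          linear_combination -hwy - ps[k] * hwy']
        exact add_mem hw (mul_mem_left _ _ hw'))
      rw [show u = (u - ps[k] * s) + ps[k] * s by ring]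
      exact add_mem (mem_sup_left hs)
        (mul_mem_right _ _ (mem_sup_right (mem_span_singleton_self _)))
  rw [isWeaklyRegular_self_iff]
  intro k hk
  have hk' : k < ps.length ∧ k < as.length := by
    simpa [and_comm] using hk
  have := H k hk'.1 0 (by lia) (key k hk'.1.le 0 (by lia))
  simpa [List.take_take, hk'.2.le] using this

lemma IsWeaklyRegular.length_le_height [IsNoetherianRing T] {l : List T}
    (hl : IsWeaklyRegular T l) (Q : Ideal T) [Q.IsPrime] (mem : ∀ r ∈ l, r ∈ Q) :
    (l.length : ℕ∞) ≤ Q.height := by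
  have reg := hl.isRegular_of_isLocalization_of_mem (Localization.AtPrime Q) Q mem
  have h := ringKrullDim_add_length_eq_ringKrullDim_of_isRegular _ reg
  rw [IsLocalization.AtPrime.ringKrullDim_eq_height Q (Localization.AtPrime Q),
    List.length_map] at h
  have : Nontrivial (Localization.AtPrime Q ⧸
      ofList (l.map (algebraMap T (Localization.AtPrime Q)))) := by
    refine Ideal.Quotient.nontrivial_iff.mpr fun h => reg.top_ne_smul ?_
    rw [h, Ideal.smul_eq_mul, Ideal.mul_top]
  have h0 := ringKrullDim_nonneg_of_nontrivial (R := Localization.AtPrime Q ⧸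
      ofList (l.map (algebraMap T (Localization.AtPrime Q))))
  have h1 : ((l.length : ℕ∞) : WithBot ℕ∞) ≤ (Q.height : WithBot ℕ∞) := by
    rw [← h]
    exact le_add_of_nonneg_left h0
  exact_mod_cast h1

end RingTheory.Sequence

/-- Over a Noetherian ring, the length of a regular sequence in a proper ideal is at most the
grade of the ideal. -/
lemma RingTheory.Sequence.IsRegular.length_le_ringGrade {T : Type*} [CommRing T]
    [IsNoetherianRing T] {J : Ideal T} (hJ : J ≠ ⊤) {l : List T}
    (hl : RingTheory.Sequence.IsRegular T l) (mem : ∀ r ∈ l, r ∈ J) :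
    l.length ≤ ringGrade J := by
  refine le_csSup ?_ ⟨l, rfl, mem, hl⟩
  obtain ⟨Q, hQ, hJQ⟩ := J.exists_le_maximal hJ
  have := hQ.isPrime
  refine ⟨Q.height.toNat, ?_⟩
  rintro _ ⟨rs, rfl, hrs, hreg⟩
  have h := hreg.toIsWeaklyRegular.length_le_height Q fun r hr => hJQ (hrs r hr)
  have hfin : Q.height ≠ ⊤ := (Ideal.height_lt_top hQ.ne_top).ne
  rw [← ENat.natCast_toNat hfin] at h
  exact_mod_cast h

open MvPolynomial in
/-- Let `R` be a Noetherian ring, `I = (f_1, …, f_m)` an ideal of `R`, and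
`S = R[z_{i,j} : 1 ≤ i ≤ n, 1 ≤ j ≤ m]`.  Let `J = (p_1, …, p_n) ⊆ S` where
`p_i = f_1 z_{i,1} + ⋯ + f_m z_{i,m}`.  Then `grade J ≥ min {n, grade I}`. -/
theorem stmt_7 {R : Type*} [CommRing R] [IsNoetherianRing R]
    (n m : ℕ) (f : Fin m → R) (I : Ideal R) (hI : I = Ideal.span (Set.range f))
    (p : Fin n → MvPolynomial (Fin n × Fin m) R)
    (hp : ∀ i, p i = ∑ j : Fin m, MvPolynomial.C (f j) * MvPolynomial.X (i, j))
    (J : Ideal (MvPolynomial (Fin n × Fin m) R)) (hJ : J = Ideal.span (Set.range p)) :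
    min n (ringGrade I) ≤ ringGrade J := by
  rcases Nat.eq_zero_or_pos (ringGrade I) with h0 | h0
  · simp [h0]
  have hne : {n : ℕ | ∃ rs : List R, rs.length = n ∧ (∀ r ∈ rs, r ∈ I) ∧
      RingTheory.Sequence.IsRegular R rs}.Nonempty :=
    Set.nonempty_iff_ne_empty.mpr fun h => h0.ne' (by simp [ringGrade, h])
  have hbdd : BddAbove {n : ℕ | ∃ rs : List R, rs.length = n ∧ (∀ r ∈ rs, r ∈ I) ∧
      RingTheory.Sequence.IsRegular R rs} := by
    by_contra h
    exact h0.ne' (Nat.sSup_of_not_bddAbove h)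
  obtain ⟨rs, hlen, hmem, hreg⟩ := Nat.sSup_mem hne hbdd
  change rs.length = ringGrade I at hlen
  have : Nontrivial R := hreg.nontrivial
  have hJker : J ≤ RingHom.ker (constantCoeff (σ := Fin n × Fin m) (R := R)) := by
    rw [hJ, Ideal.span_le]
    rintro _ ⟨i, rfl⟩
    simp [hp, RingHom.mem_ker]
  have hJtop : J ≠ ⊤ := fun h =>
    RingHom.ker_ne_top (constantCoeff (σ := Fin n × Fin m) (R := R)) (top_le_iff.mp (h ▸ hJker))
  have hweak : RingTheory.Sequence.IsWeaklyRegular (MvPolynomial (Fin n × Fin m) R)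
      ((List.ofFn p).take (rs.map (algebraMap R (MvPolynomial (Fin n × Fin m) R))).length) := by
    refine hreg.toIsWeaklyRegular.of_flat.exchange fun k hk i hi h => ?_
    rw [← Ideal.span_union] at h ⊢
    simp only [List.getElem_map, List.getElem_ofFn, hp] at h ⊢
    rw [List.length_map] at hi
    have hk' : k < n := by simpa using hk
    refine mem_span_of_linear_form_mul_mem (fun j => ((⟨k, hk'⟩ : Fin n), j))
      (fun a b hab => by simpa using hab) f _ ?_ rs[i]
      (hI ▸ hmem _ (List.getElem_mem hi)) h
    rintro t (ht | ht)
    · obtain ⟨l, hl, rfl⟩ := List.mem_take_iff_getElem.mp ht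
      rw [List.getElem_ofFn, hp]
      refine Subalgebra.sum_mem _ fun j _ => Subalgebra.mul_mem _ (Subalgebra.algebraMap_mem _ _)
        (X_mem_supported.mpr ?_)
      have hlk : l < k := by lia
      simp [hlk.ne']
    · obtain ⟨r, -, rfl⟩ := List.mem_map.mp (List.mem_of_mem_take ht)
      exact Subalgebra.algebraMap_mem _ r
  have hmemJ : ∀ r ∈ (List.ofFn p).take
      (rs.map (algebraMap R (MvPolynomial (Fin n × Fin m) R))).length, r ∈ J := by
    intro r hr
    rw [hJ]
    exact Ideal.subset_span (by simpa using List.mem_of_mem_take hr)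
  have hregular : RingTheory.Sequence.IsRegular (MvPolynomial (Fin n × Fin m) R)
      ((List.ofFn p).take (rs.map (algebraMap R (MvPolynomial (Fin n × Fin m) R))).length) := by
    refine ⟨hweak, fun h => hJtop (top_le_iff.mp ?_)⟩
    rw [h, Ideal.smul_eq_mul, Ideal.mul_top]
    exact Ideal.span_le.mpr hmemJ
  have := hregular.length_le_ringGrade hJtop hmemJ
  simpa [hlen, min_comm] using this
end

section
/- Let R be a Noetherian ring. For 1 ≤ j ≤ s let I_j = (f_{j,1}, …, f_{j,m_j}) be ideals of R, and let S = R[z_{i,j,k}] be a polynomial ring in the indicated variables (1 ≤ i ≤ r, 1 ≤ j ≤ s, 1 ≤ k ≤ m_j). Let M be the r×s matrix with entries p_{i,j} = Σ_k f_{j,k} z_{i,j,k}. Then for every 1 ≤ t ≤ min{r, s}, grade(I_t(M)) ≥ min{r − t + 1, g}, where g = min_j grade(I_j) and I_t(M) is the ideal of t×t minors of M. -/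
namespace Ideal

open Polynomial

variable {A : Type*} [CommRing A]

/-- The saturation of an ideal with respect to a multiplicative set: the preimage of its
extension to the localization. -/
def saturate (W : Submonoid A) (𝔞 : Ideal A) : Ideal A where
  carrier := {b | ∃ w ∈ W, w * b ∈ 𝔞}
  zero_mem' := ⟨1, W.one_mem, by simp⟩
  add_mem' := by
    rintro b c ⟨v, hv, hb⟩ ⟨w, hw, hc⟩
    refine ⟨v * w, W.mul_mem hv hw, ?_⟩
    have := 𝔞.add_mem (𝔞.mul_mem_left w hb) (𝔞.mul_mem_left v hc)
    convert this using 1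
    ring
  smul_mem' := by
    rintro c b ⟨w, hw, hb⟩
    refine ⟨w, hw, ?_⟩
    have := 𝔞.mul_mem_left c hb
    convert this using 1
    simp only [smul_eq_mul]
    ring

theorem mem_saturate {W : Submonoid A} {𝔞 : Ideal A} {b : A} :
    b ∈ saturate W 𝔞 ↔ ∃ w ∈ W, w * b ∈ 𝔞 := Iff.rfl

theorem mem_saturate_of_mul_mem {W : Submonoid A} {𝔞 : Ideal A} {w b : A} (hw : w ∈ W)
    (h : w * b ∈ saturate W 𝔞) : b ∈ saturate W 𝔞 := by
  obtain ⟨v, hv, h⟩ := h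
  exact ⟨v * w, W.mul_mem hv hw, by rwa [mul_assoc]⟩

theorem saturate_bot (𝔞 : Ideal A) : saturate ⊥ 𝔞 = 𝔞 := by
  ext b
  simp [mem_saturate]

theorem le_saturate (W : Submonoid A) (𝔞 : Ideal A) : 𝔞 ≤ saturate W 𝔞 :=
  fun b hb => ⟨1, W.one_mem, by simpa using hb⟩

theorem mem_saturate_sup_span {W : Submonoid A} {𝔞 : Ideal A} {y b : A} :
    b ∈ saturate W (𝔞 ⊔ span {y}) ↔ ∃ w ∈ W, ∃ c, w * b - y * c ∈ 𝔞 := by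
  simp only [mem_saturate]
  refine exists_congr fun w => and_congr_right fun _ => ?_
  rw [Submodule.mem_sup]
  constructor
  · rintro ⟨a, ha, z, hz, h⟩
    obtain ⟨c, rfl⟩ := mem_span_singleton'.1 hz
    exact ⟨c, by rwa [← h, mul_comm y, add_sub_cancel_right]⟩
  · rintro ⟨c, hc⟩
    exact ⟨_, hc, y * c, mul_mem_right _ _ (mem_span_singleton_self y), by ring⟩

/-- Multiplication by `x` is injective on `A ⧸ 𝔠`. -/
def IsRegularMod (𝔠 : Ideal A) (x : A) : Prop := ∀ b, x * b ∈ 𝔠 → b ∈ 𝔠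

theorem IsRegularMod.mul {𝔠 : Ideal A} {x y : A} (hx : IsRegularMod 𝔠 x)
    (hy : IsRegularMod 𝔠 y) : IsRegularMod 𝔠 (x * y) :=
  fun b hb => hy b (hx _ (by rwa [← mul_assoc]))

theorem IsRegularMod.pow {𝔠 : Ideal A} {x : A} (hx : IsRegularMod 𝔠 x) (n : ℕ) :
    IsRegularMod 𝔠 (x ^ n) := by
  induction n with
  | zero => exact fun b hb => by simpa using hb
  | succ n ih => exact pow_succ x n ▸ ih.mul hx

theorem IsRegularMod.saturate {W : Submonoid A} {𝔞 : Ideal A} {x : A}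
    (hx : IsRegularMod 𝔞 x) : IsRegularMod (saturate W 𝔞) x := by
  rintro b ⟨w, hw, h⟩
  exact ⟨w, hw, hx _ (by rwa [mul_left_comm])⟩

theorem isRegularMod_saturate_of_mem {W : Submonoid A} {𝔞 : Ideal A} {w : A} (hw : w ∈ W) :
    IsRegularMod (saturate W 𝔞) w :=
  fun _ => mem_saturate_of_mul_mem hw

theorem isRegularMod_iff_isSMulRegular {𝔠 : Ideal A} {x : A} :
    IsRegularMod 𝔠 x ↔ IsSMulRegular (A ⧸ 𝔠) x := by
  rw [isSMulRegular_iff_right_eq_zero_of_smul]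
  constructor
  · intro h b
    obtain ⟨b, rfl⟩ := Quotient.mk_surjective b
    intro hb
    refine Quotient.eq_zero_iff_mem.2 (h b (Quotient.eq_zero_iff_mem.1 ?_))
    simpa [Algebra.smul_def] using hb
  · intro h b hb
    refine Quotient.eq_zero_iff_mem.1 (h _ ?_)
    simpa [Algebra.smul_def] using Quotient.eq_zero_iff_mem.2 hb

/-- An ideal of a Noetherian ring which is not contained in the zero-divisors of `A ⧸ 𝔟`, nor in
those of `A ⧸ 𝔠`, contains an element regular on both. -/
theorem exists_isRegularMod [IsNoetherianRing A] {I 𝔟 𝔠 : Ideal A}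
    (hb : ∀ b, (∀ i ∈ I, i * b ∈ 𝔟) → b ∈ 𝔟) (hc : ∀ b, (∀ i ∈ I, i * b ∈ 𝔠) → b ∈ 𝔠) :
    ∃ z ∈ I, IsRegularMod 𝔟 z ∧ IsRegularMod 𝔠 z := by
  have key : Subsingleton ((A ⧸ I) →ₗ[A] (A ⧸ 𝔟) × (A ⧸ 𝔠)) := by
    refine subsingleton_of_forall_eq 0 fun f => ?_
    obtain ⟨u, hu⟩ := Quotient.mk_surjective (f 1).1
    obtain ⟨v, hv⟩ := Quotient.mk_surjective (f 1).2
    have hf : ∀ i ∈ I, i • f 1 = 0 := by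
      intro i hi
      rw [← map_smul, Algebra.smul_def, mul_one, Quotient.algebraMap_eq,
        Quotient.eq_zero_iff_mem.2 hi, map_zero]
    have hu0 : u ∈ 𝔟 := hb u fun i hi => Quotient.eq_zero_iff_mem.1 (by
      simpa [Algebra.smul_def, hu] using congrArg Prod.fst (hf i hi))
    have hv0 : v ∈ 𝔠 := hc v fun i hi => Quotient.eq_zero_iff_mem.1 (by
      simpa [Algebra.smul_def, hv] using congrArg Prod.snd (hf i hi))
    have h1 : f 1 = 0 := by
      refine Prod.ext ?_ ?_
      · rw [← hu, Quotient.eq_zero_iff_mem.2 hu0, Prod.fst_zero]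
      · rw [← hv, Quotient.eq_zero_iff_mem.2 hv0, Prod.snd_zero]
    ext
    all_goals simp [h1]
  obtain ⟨z, hz, hreg⟩ := IsSMulRegular.subsingleton_linearMap_iff.1 key
  rw [annihilator_quotient] at hz
  refine ⟨z, hz, isRegularMod_iff_isSMulRegular.2 ?_, isRegularMod_iff_isSMulRegular.2 ?_⟩
  · intro a b hab
    exact congrArg Prod.fst (@hreg (a, 0) (b, 0) (Prod.ext hab rfl))
  · intro a b hab
    exact congrArg Prod.snd (@hreg (0, a) (0, b) (Prod.ext rfl hab))

/-- `HasDepth W n I 𝔞` says that `I` contains a sequence of length `n` which is weakly regular on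
the localization of `A ⧸ 𝔞` at `W`. -/
def HasDepth (W : Submonoid A) : ℕ → Ideal A → Ideal A → Prop
  | 0, _, _ => True
  | n + 1, I, 𝔞 => ∃ x ∈ I, IsRegularMod (saturate W 𝔞) x ∧ HasDepth W n I (𝔞 ⊔ span {x})

namespace HasDepth

variable {W : Submonoid A} {I J 𝔞 : Ideal A} {m n : ℕ}

theorem mono_ideal (hIJ : I ≤ J) (h : HasDepth W n I 𝔞) : HasDepth W n J 𝔞 := by
  induction n generalizing 𝔞 with
  | zero => trivial
  | succ n ih =>
    obtain ⟨x, hx, hreg, h⟩ := h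
    exact ⟨x, hIJ hx, hreg, ih h⟩

theorem of_le (hmn : m ≤ n) (h : HasDepth W n I 𝔞) : HasDepth W m I 𝔞 := by
  induction m generalizing n 𝔞 with
  | zero => trivial
  | succ m ih =>
    obtain ⟨n, rfl⟩ := Nat.exists_eq_add_of_lt hmn
    obtain ⟨x, hx, hreg, h⟩ := h
    exact ⟨x, hx, hreg, ih (by omega) h⟩

theorem localize (h : HasDepth ⊥ n I 𝔞) : HasDepth W n I 𝔞 := by
  induction n generalizing 𝔞 with
  | zero => trivial
  | succ n ih =>
    obtain ⟨x, hx, hreg, h⟩ := h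
    rw [saturate_bot] at hreg
    exact ⟨x, hx, hreg.saturate, ih h⟩

theorem top (n : ℕ) (𝔞 : Ideal A) : HasDepth W n ⊤ 𝔞 := by
  induction n generalizing 𝔞 with
  | zero => trivial
  | succ n ih => exact ⟨1, trivial, fun b hb => by simpa using hb, ih _⟩

theorem mem_of_forall_mul_mem_sup {x y z b : A}
    (hx : IsRegularMod (saturate W 𝔞) x) (hy : IsRegularMod (saturate W 𝔞) y)
    (hz : IsRegularMod (saturate W (𝔞 ⊔ span {x})) z)
    (hxb : x * b ∈ saturate W (𝔞 ⊔ span {y})) (hzb : z * b ∈ saturate W (𝔞 ⊔ span {y})) :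
    b ∈ saturate W (𝔞 ⊔ span {y}) := by
  obtain ⟨w, hw, c, hc⟩ := mem_saturate_sup_span.1 hxb
  obtain ⟨v, hv, d, hd⟩ := mem_saturate_sup_span.1 hzb
  have h1 : w * x * d - v * z * c ∈ saturate W 𝔞 := by
    refine hy _ (le_saturate _ _ ?_)
    have := 𝔞.sub_mem (𝔞.mul_mem_left (v * z) hc) (𝔞.mul_mem_left (w * x) hd)
    convert this using 1
    ring
  have h2 : c ∈ saturate W (𝔞 ⊔ span {x}) := by
    refine hz _ (mem_saturate_of_mul_mem hv ?_)
    obtain ⟨u, hu, h⟩ := h1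
    refine mem_saturate_sup_span.2 ⟨u, hu, u * w * d, ?_⟩
    have := 𝔞.neg_mem h
    convert this using 1
    ring
  obtain ⟨u, hu, e, he⟩ := mem_saturate_sup_span.1 h2
  have h3 : u * w * b - y * e ∈ saturate W 𝔞 := by
    refine hx _ (le_saturate _ _ ?_)
    have := 𝔞.add_mem (𝔞.mul_mem_left u hc) (𝔞.mul_mem_left y he)
    convert this using 1
    ring
  obtain ⟨v', hv', h⟩ := h3
  refine mem_saturate_sup_span.2 ⟨v' * (u * w), W.mul_mem hv' (W.mul_mem hu hw), v' * e, ?_⟩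
  convert h using 1
  ring

theorem isRegularMod_sup_swap {y z : A} (hy : IsRegularMod (saturate W 𝔞) y)
    (hz : IsRegularMod (saturate W (𝔞 ⊔ span {y})) z) :
    IsRegularMod (saturate W (𝔞 ⊔ span {z})) y := by
  intro b hb
  obtain ⟨w, hw, c, hc⟩ := mem_saturate_sup_span.1 hb
  have h1 : c ∈ saturate W (𝔞 ⊔ span {y}) := by
    refine hz _ (mem_saturate_sup_span.2 ⟨1, W.one_mem, w * b, ?_⟩)
    have := 𝔞.neg_mem hc
    convert this using 1
    ring
  obtain ⟨u, hu, e, he⟩ := mem_saturate_sup_span.1 h1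
  obtain ⟨v, hv, h⟩ : u * w * b - z * e ∈ saturate W 𝔞 := by
    refine hy _ (le_saturate _ _ ?_)
    have := 𝔞.add_mem (𝔞.mul_mem_left u hc) (𝔞.mul_mem_left z he)
    convert this using 1
    ring
  refine mem_saturate_sup_span.2 ⟨v * (u * w), W.mul_mem hv (W.mul_mem hu hw), v * e, ?_⟩
  convert h using 1
  ring

/-- Killing a single regular element, in `I` or not, lowers the depth by at most one. -/
theorem sup_span_singleton [IsNoetherianRing A] {y : A} (h : HasDepth W (n + 1) I 𝔞)
    (hy : IsRegularMod (saturate W 𝔞) y) : HasDepth W n I (𝔞 ⊔ span {y}) := by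
  induction n generalizing 𝔞 y with
  | zero => trivial
  | succ n ih =>
    obtain ⟨x, hx, hxreg, h⟩ := h
    obtain ⟨z₀, hz₀, hz₀reg, -⟩ := id h
    obtain ⟨z, hz, hzy, hzx⟩ : ∃ z ∈ I, IsRegularMod (saturate W (𝔞 ⊔ span {y})) z ∧
        IsRegularMod (saturate W (𝔞 ⊔ span {x})) z :=
      exists_isRegularMod
        (fun b hb => mem_of_forall_mul_mem_sup hxreg hy hz₀reg (hb x hx) (hb z₀ hz₀))
        (fun b hb => hz₀reg b (hb z₀ hz₀))
    have hxz : HasDepth W (n + 1) I (𝔞 ⊔ span {z}) :=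
      ⟨x, hx, isRegularMod_sup_swap hxreg hzx, by
        rw [sup_right_comm]
        exact ih h hzx⟩
    refine ⟨z, hz, hzy, ?_⟩
    rw [sup_right_comm]
    exact ih hxz (isRegularMod_sup_swap hy hzy)

/-- Depth can be checked after inverting each generator of an ideal which is itself deep enough. -/
theorem of_forall_powers [IsNoetherianRing A] {T : Set A} (hJ : HasDepth ⊥ n (span T) 𝔞)
    (hI : ∀ a ∈ T, HasDepth (Submonoid.powers a) n I 𝔞) : HasDepth ⊥ n I 𝔞 := by
  induction n generalizing 𝔞 with
  | zero => trivial
  | succ n ih =>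
    obtain ⟨y, hy, hyreg, -⟩ := id hJ
    rw [saturate_bot] at hyreg
    have hcolon : ∀ b, (∀ i ∈ I, i * b ∈ 𝔞) → b ∈ 𝔞 := by
      intro b hb
      have hle : span T ≤ (Submodule.colon 𝔞 {b}).radical := by
        rw [span_le]
        intro a ha
        obtain ⟨x, hx, hxreg, -⟩ := hI a ha
        obtain ⟨_, ⟨N, rfl⟩, hN⟩ := hxreg b (le_saturate _ _ (hb x hx))
        exact ⟨N, Submodule.mem_colon_singleton.2 hN⟩
      obtain ⟨N, hN⟩ := hle hy
      exact hyreg.pow N b (Submodule.mem_colon_singleton.1 hN)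
    obtain ⟨x, hx, hxreg, -⟩ := exists_isRegularMod hcolon hcolon
    have hxy := hxreg.mul hyreg
    refine ⟨x * y, I.mul_mem_right _ hx, by rwa [saturate_bot], ih ?_ ?_⟩
    · exact hJ.sup_span_singleton (by rwa [saturate_bot])
    · exact fun a ha => (hI a ha).sup_span_singleton hxy.saturate

/-- A proper ideal of a Noetherian ring has finite depth. -/
theorem exists_not [IsNoetherianRing A] (hI : I ≠ ⊤) (h𝔞 : 𝔞 ≤ I) :
    ∃ n, ¬ HasDepth ⊥ n I 𝔞 := by
  induction 𝔞 using WellFoundedGT.induction with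
  | ind 𝔞 ih =>
    by_contra! hall
    obtain ⟨x, hx, hreg, -⟩ := hall 1
    rw [saturate_bot] at hreg
    have hx𝔞 : x ∉ 𝔞 := fun hmem =>
      hI (top_le_iff.1 (((eq_top_iff_one 𝔞).2 (hreg 1 (by simpa using hmem))).ge.trans h𝔞))
    obtain ⟨n, hn⟩ := ih (𝔞 ⊔ span {x})
      (left_lt_sup.2 fun hle => hx𝔞 (hle (mem_span_singleton_self x)))
      (sup_le h𝔞 ((span_singleton_le_iff_mem I).2 hx))
    exact hn ((hall (n + 1)).sup_span_singleton (by rwa [saturate_bot]))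

theorem map_C {σ : Type*} (h : HasDepth ⊥ n I 𝔞) :
    HasDepth ⊥ n (I.map (MvPolynomial.C (σ := σ))) (𝔞.map MvPolynomial.C) := by
  induction n generalizing 𝔞 with
  | zero => trivial
  | succ n ih =>
    obtain ⟨x, hx, hreg, h⟩ := h
    rw [saturate_bot] at hreg
    refine ⟨MvPolynomial.C x, mem_map_of_mem _ hx, ?_, ?_⟩
    · rw [saturate_bot]
      intro b hb
      rw [MvPolynomial.mem_map_C_iff] at hb ⊢
      exact fun m => hreg _ (by simpa using hb m)
    · simpa [map_sup, map_span] using ih h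

theorem iff_exists_list : HasDepth ⊥ n I 𝔞 ↔ ∃ rs : List A, rs.length = n ∧ (∀ r ∈ rs, r ∈ I) ∧
    ∀ i (h : i < rs.length), IsRegularMod (𝔞 ⊔ ofList (rs.take i)) rs[i] := by
  induction n generalizing 𝔞 with
  | zero => exact ⟨fun _ => ⟨[], by simp⟩, fun _ => trivial⟩
  | succ n ih =>
    simp only [HasDepth, saturate_bot, ih]
    constructor
    · rintro ⟨x, hx, hreg, rs, hlen, hmem, h⟩
      refine ⟨x :: rs, by simp [hlen], by simpa [hx] using hmem, ?_⟩
      rintro (_ | i) hi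
      · simpa using hreg
      · simpa [sup_assoc] using h i (by simpa using hi)
    · rintro ⟨_ | ⟨x, rs⟩, hlen, hmem, h⟩
      · simp at hlen
      · refine ⟨x, hmem x (by simp), by simpa using! h 0 (by simp), rs, by simpa using hlen,
          fun r hr => hmem r (by simp [hr]), fun i hi => ?_⟩
        simpa [sup_assoc] using! h (i + 1) (by simpa using hi)

theorem iff_exists_isWeaklyRegular : HasDepth ⊥ n I ⊥ ↔
    ∃ rs : List A, rs.length = n ∧ (∀ r ∈ rs, r ∈ I) ∧
      RingTheory.Sequence.IsWeaklyRegular A rs := by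
  have hreg : ∀ (K : Ideal A) (x : A),
      IsSMulRegular (A ⧸ (K • ⊤ : Submodule A A)) x ↔ IsRegularMod K x := fun K x =>
    (isRegularMod_iff_isSMulRegular (𝔠 := K • ⊤)).symm.trans
      (by rw [smul_eq_mul, Ideal.mul_top])
  simp only [iff_exists_list, RingTheory.Sequence.isWeaklyRegular_iff, hreg, bot_sup_eq]

end HasDepth

/-- If a ring homomorphism to `A[X]` deforms `p` to `p + x X`, and preserves `𝔞`, then `p` is at
least as regular as `x`. -/
theorem IsRegularMod.of_deformation {W : Submonoid A} {𝔞 : Ideal A} {p x : A}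
    (hx : IsRegularMod (Ideal.saturate W 𝔞) x) (φ : A →+* A[X]) (hφ : ∀ b, (φ b).eval 0 = b)
    (hW : ∀ w ∈ W, φ w = C w) (h𝔞 : 𝔞.map φ ≤ 𝔞.map C) (hp : φ p = C p + C x * X) :
    IsRegularMod (Ideal.saturate W 𝔞) p := by
  rintro q ⟨w, hw, hq⟩
  have hmem : φ (w * (p * q)) ∈ 𝔞.map C := h𝔞 (mem_map_of_mem _ hq)
  rw [map_mul, map_mul, hW w hw, hp, mem_map_C_iff] at hmem
  have hstep : ∀ k, (φ q).coeff (k + 1) ∈ Ideal.saturate W 𝔞 → (φ q).coeff k ∈ Ideal.saturate W 𝔞 := by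
    intro k hk
    refine hx _ ?_
    have h1 : p * (φ q).coeff (k + 1) + x * (φ q).coeff k ∈ Ideal.saturate W 𝔞 :=
      ⟨w, hw, by simpa [add_mul, mul_assoc, coeff_X_mul] using hmem (k + 1)⟩
    exact (Submodule.add_mem_iff_right _ ((Ideal.saturate W 𝔞).mul_mem_left p hk)).1 h1
  have hcoeff : ∀ d k, (φ q).natDegree < k + d → (φ q).coeff k ∈ Ideal.saturate W 𝔞 := by
    intro d
    induction d with
    | zero =>
      intro k hk
      rw [coeff_eq_zero_of_natDegree_lt (by simpa using hk)]
      exact zero_mem _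
    | succ d ih => exact fun k hk => hstep k (ih (k + 1) (by omega))
  have := hcoeff ((φ q).natDegree + 1) 0 (by omega)
  rwa [coeff_zero_eq_eval_zero, hφ] at this

/-- A family of elements that can be deformed independently of one another in the directions of
`F` generates an ideal at least as deep as `F`, up to the size of the family. -/
theorem HasDepth.of_deformations [IsNoetherianRing A] {W : Submonoid A} {F : Ideal A}
    {ι : Type*} [Fintype ι] [DecidableEq ι] (q : ι → A)
    (hq : ∀ i, ∀ x ∈ F, ∃ φ : A →+* A[X], (∀ b, (φ b).eval 0 = b) ∧ (∀ w ∈ W, φ w = C w) ∧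
      (∀ i', i' ≠ i → φ (q i') = C (q i')) ∧ ∃ w ∈ W, φ (q i) = C (q i) + C (w * x) * X)
    {n : ℕ} (T : Finset ι) (hn : n + T.card ≤ Fintype.card ι)
    (hF : HasDepth W n F (span (q '' T))) :
    HasDepth W n (span (Set.range q)) (span (q '' T)) := by
  induction n generalizing T with
  | zero => trivial
  | succ n ih =>
    obtain ⟨i, hi⟩ : ∃ i, i ∉ T := by
      by_contra! hall
      have := Finset.card_le_card (s := Finset.univ) (t := T) fun i _ => hall i
      rw [Finset.card_univ] at this
      omega
    obtain ⟨x, hx, hxreg, -⟩ := id hF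
    obtain ⟨φ, hφ, hφW, hφq, w, hw, hφi⟩ := hq i x hx
    have hreg : IsRegularMod (saturate W (span (q '' T))) (q i) := by
      refine ((isRegularMod_saturate_of_mem hw).mul hxreg).of_deformation φ hφ hφW ?_ hφi
      rw [map_span, span_le]
      rintro _ ⟨_, ⟨i', hi', rfl⟩, rfl⟩
      rw [hφq i' (by rintro rfl; exact hi hi')]
      exact mem_map_of_mem _ (subset_span ⟨i', hi', rfl⟩)
    have hspan : span (q '' T) ⊔ span {q i} = span (q '' (insert i T : Finset ι)) := by
      rw [Finset.coe_insert, Set.image_insert_eq, span_insert, sup_comm]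
    refine ⟨q i, subset_span ⟨i, rfl⟩, hreg, ?_⟩
    rw [hspan]
    refine ih _ (by rw [Finset.card_insert_of_notMem hi]; omega) ?_
    rw [← hspan]
    exact hF.sup_span_singleton hreg

/-- The maximal minors of an `r × j` matrix whose entries in the column `k` can be deformed
independently in the directions of `F k` generate an ideal of depth at least
`min (r - j + 1) g`, if each `F k` has depth at least `g`. -/
theorem HasDepth.span_det_submatrix [IsNoetherianRing A] {r s g : ℕ}
    (M : Matrix (Fin r) (Fin s) A) (F : Fin s → Ideal A) (hF : ∀ k, HasDepth ⊥ g (F k) ⊥)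
    (hM : ∀ i k, ∀ x ∈ F k, ∃ φ : A →+* A[X], (∀ b, (φ b).eval 0 = b) ∧
      (∀ i' k', (i', k') ≠ (i, k) → φ (M i' k') = C (M i' k')) ∧
      φ (M i k) = C (M i k) + C x * X)
    {j : ℕ} (c : Fin j → Fin s) (hc : Function.Injective c) (hj : j ≤ r) :
    HasDepth ⊥ (min (r - j + 1) g)
      (span {d | ∃ ri : Fin j → Fin r, Function.Injective ri ∧ d = (M.submatrix ri c).det}) ⊥ := by
  induction j with
  | zero =>
    refine (HasDepth.top _ _).mono_ideal (top_le_iff.2 ((eq_top_iff_one _).2 ?_))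
    exact subset_span ⟨Fin.elim0, fun a => a.elim0, by simp⟩
  | succ j ih =>
    refine of_forall_powers
      ((ih (c ∘ Fin.succ) (hc.comp (Fin.succ_injective j)) (by omega)).of_le (by omega)) ?_
    rintro _ ⟨ri, hri, rfl⟩
    set Δ := (M.submatrix ri (c ∘ Fin.succ)).det with hΔ
    let q : {i // i ∉ Set.range ri} → A := fun i => (M.submatrix (Fin.cons i.1 ri) c).det
    have hcard : Fintype.card {i // i ∉ Set.range ri} = r - j := by
      classical
      rw [Fintype.card_subtype_compl, Fintype.card_fin]
      congr 1
      exact (Set.card_range_of_injective hri).trans (Fintype.card_fin j)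
    have hq : HasDepth (Submonoid.powers Δ) (min (r - (j + 1) + 1) g) (span (Set.range q))
        (span (q '' (∅ : Finset {i // i ∉ Set.range ri}))) := by
      classical
      refine HasDepth.of_deformations (F := F (c 0)) q ?_ ∅ ?_ ?_
      · intro i x hx
        obtain ⟨φ, hφ, hφM, hφi⟩ := hM i (c 0) x hx
        have hdet : ∀ {l : ℕ} (ρ : Fin l → Fin r) (κ : Fin l → Fin s),
            (∀ a b, (ρ a, κ b) ≠ (i.1, c 0)) →
            φ (M.submatrix ρ κ).det = C (M.submatrix ρ κ).det := by
          intro l ρ κ h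
          rw [RingHom.map_det, RingHom.map_det]
          congr 1
          ext1 a b
          exact hφM _ _ (h a b)
        have hΔφ : φ Δ = C Δ := hdet _ _ fun a b h => i.2 ⟨a, congrArg Prod.fst h⟩
        refine ⟨φ, hφ, ?_, ?_, Δ, Submonoid.mem_powers Δ, ?_⟩
        · rintro _ ⟨N, rfl⟩
          simp [hΔφ]
        · intro i' hi'
          refine hdet _ _ fun a b h => ?_
          have ha := congrArg Prod.fst h
          revert ha
          refine Fin.cases ?_ (fun a => ?_) a
          · exact fun ha => hi' (Subtype.ext ha)
          · exact fun ha => i.2 ⟨a, ha⟩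
        · have hsub : ∀ b : Fin (j + 1),
              (M.submatrix (Fin.cons i.1 ri) c).submatrix Fin.succ b.succAbove =
                M.submatrix ri (c ∘ b.succAbove) := fun b => rfl
          have hrow : ∀ b : Fin j, φ (M i.1 (c b.succ)) = C (M i.1 (c b.succ)) := fun b =>
            hφM _ _ fun h => b.succ_ne_zero (hc (congrArg Prod.snd h))
          have hminor : ∀ b : Fin (j + 1), φ (M.submatrix ri (c ∘ b.succAbove)).det =
              C (M.submatrix ri (c ∘ b.succAbove)).det :=
            fun b => hdet _ _ fun a _ h => i.2 ⟨a, congrArg Prod.fst h⟩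
          have h0 : M.submatrix ri (c ∘ (0 : Fin (j + 1)).succAbove) =
              M.submatrix ri (c ∘ Fin.succ) := by rw [Fin.succAbove_zero]
          simp only [q, Matrix.det_succ_row_zero, hsub, map_sum, map_add, map_mul,
            map_pow, map_neg, map_one, hminor, Fin.sum_univ_succ, Matrix.submatrix_apply, Fin.cons_zero, hrow, hφi,
            h0, ← hΔ, hΔφ]
          simp
          ring
      · rw [hcard, Finset.card_empty]
        omega
      · simpa using ((hF (c 0)).of_le (min_le_right _ _)).localize
    rw [Finset.coe_empty, Set.image_empty, span_empty] at hq
    refine hq.mono_ideal (span_mono ?_)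
    rintro _ ⟨i, rfl⟩
    exact ⟨Fin.cons i.1 ri, Fin.cons_injective_iff.2 ⟨i.2, hri⟩, rfl⟩

end Ideal

theorem hasDepth_ringGrade {R : Type*} [CommRing R] (I : Ideal R) :
    I.HasDepth ⊥ (ringGrade I) ⊥ := by
  rcases Nat.eq_zero_or_pos (ringGrade I) with h | h
  · rw [h]
    trivial
  · obtain ⟨rs, hlen, hmem, hreg⟩ := Nat.sSup_mem (s := {n : ℕ | ∃ rs : List R,
        rs.length = n ∧ (∀ r ∈ rs, r ∈ I) ∧ RingTheory.Sequence.IsRegular R rs})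
      (Set.nonempty_iff_ne_empty.2 fun he => by simp [ringGrade, he] at h)
      (by_contra fun hb => by simp [ringGrade, Nat.sSup_of_not_bddAbove hb] at h)
    exact Ideal.HasDepth.iff_exists_isWeaklyRegular.2 ⟨rs, hlen, hmem, hreg.toIsWeaklyRegular⟩

theorem Ideal.HasDepth.le_ringGrade {R : Type*} [CommRing R] [IsNoetherianRing R] {I : Ideal R}
    {n : ℕ} (hI : I ≠ ⊤) (h : I.HasDepth ⊥ n ⊥) : n ≤ ringGrade I := by
  obtain ⟨N, hN⟩ := Ideal.HasDepth.exists_not hI bot_le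
  refine le_csSup ⟨N, ?_⟩ ?_
  · rintro _ ⟨rs, rfl, hmem, hreg⟩
    by_contra! hlt
    exact hN ((iff_exists_isWeaklyRegular.2 ⟨rs, rfl, hmem, hreg.toIsWeaklyRegular⟩).of_le hlt.le)
  · obtain ⟨rs, hlen, hmem, hreg⟩ := iff_exists_isWeaklyRegular.1 h
    refine ⟨rs, hlen, hmem, hreg, fun htop => hI (top_le_iff.1 ?_)⟩
    rw [smul_eq_mul, Ideal.mul_top] at htop
    exact htop.le.trans (Ideal.span_le.2 hmem)

open MvPolynomial in
/-- Let `R` be a Noetherian ring.  For `1 ≤ j ≤ s` let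
`I_j = (f_{j,1}, …, f_{j,m_j})` be ideals of `R`, and let `S = R[z_{i,j,k}]` be a polynomial
ring in the indicated variables (`1 ≤ i ≤ r`, `1 ≤ j ≤ s`, `1 ≤ k ≤ m_j`).  Let `M` be the
`r×s` matrix with entries `p_{i,j} = Σ_k f_{j,k} z_{i,j,k}`.  Then for every
`1 ≤ t ≤ min {r, s}`, `grade (I_t(M)) ≥ min {r − t + 1, g}`, where `g = min_j grade I_j`
and `I_t(M)` is the ideal of `t×t` minors of `M`. -/
theorem stmt_8 {R : Type*} [CommRing R] [IsNoetherianRing R]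
    (r s : ℕ) (hr : 1 ≤ r) (hs : 1 ≤ s) (m : Fin s → ℕ) (f : (j : Fin s) → Fin (m j) → R)
    (M : Matrix (Fin r) (Fin s) (MvPolynomial (Fin r × Σ j : Fin s, Fin (m j)) R))
    (hM : ∀ i j, M i j = ∑ k : Fin (m j), MvPolynomial.C (f j k) * MvPolynomial.X (i, ⟨j, k⟩))
    (g : ℕ) (hg : g = ⨅ j : Fin s, ringGrade (Ideal.span (Set.range (f j))))
    (t : ℕ) (ht1 : 1 ≤ t) (ht2 : t ≤ min r s)
    (It : Ideal (MvPolynomial (Fin r × Σ j : Fin s, Fin (m j)) R))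
    (hIt : It = Ideal.span {d | ∃ (ri : Fin t → Fin r) (ci : Fin t → Fin s),
      Function.Injective ri ∧ Function.Injective ci ∧ d = (M.submatrix ri ci).det}) :
    min (r - t + 1) g ≤ ringGrade It := by
  subst hg hIt
  rcases subsingleton_or_nontrivial R with hR | hR
  · refine (min_le_right _ _).trans ((ciInf_le (OrderBot.bddBelow _) ⟨0, hs⟩).trans ?_)
    refine (csSup_le' ?_).trans (Nat.zero_le _)
    rintro _ ⟨rs, -, -, hreg⟩
    exact absurd (Subsingleton.elim _ _) hreg.top_ne_smul
  refine Ideal.HasDepth.le_ringGrade ?_ ?_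
  · intro htop
    have hle : Ideal.span {d | ∃ (ri : Fin t → Fin r) (ci : Fin t → Fin s),
        Function.Injective ri ∧ Function.Injective ci ∧ d = (M.submatrix ri ci).det} ≤
        RingHom.ker (MvPolynomial.constantCoeff (σ := Fin r × Σ j : Fin s, Fin (m j))
          (R := R)) := by
      rw [Ideal.span_le]
      rintro _ ⟨ri, ci, -, -, rfl⟩
      rw [SetLike.mem_coe, RingHom.mem_ker, RingHom.map_det]
      have : Nonempty (Fin t) := ⟨⟨0, ht1⟩⟩
      rw [← Matrix.det_zero (n := Fin t)]
      congr 1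
      ext a b
      simp [hM]
    rw [htop, top_le_iff] at hle
    exact RingHom.ker_ne_top _ hle
  · have hdepth := Ideal.HasDepth.span_det_submatrix M
      (fun j => (Ideal.span (Set.range (f j))).map MvPolynomial.C)
      (g := ⨅ j : Fin s, ringGrade (Ideal.span (Set.range (f j)))) (fun j => ?_) ?_
      (Fin.castLE (ht2.trans (min_le_right _ _))) (Fin.castLE_injective _)
      (ht2.trans (min_le_left _ _))
    · refine hdepth.mono_ideal (Ideal.span_mono ?_)
      rintro _ ⟨ri, hri, rfl⟩
      exact ⟨ri, _, hri, Fin.castLE_injective _, rfl⟩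
    · simpa using ((hasDepth_ringGrade (Ideal.span (Set.range (f j)))).of_le
        (ciInf_le (f := fun j => ringGrade (Ideal.span (Set.range (f j))))
          (OrderBot.bddBelow _) j)).map_C
          (σ := Fin r × Σ j : Fin s, Fin (m j))
    · intro i j x hx
      rw [Ideal.map_span, ← Set.range_comp] at hx
      obtain ⟨h, rfl⟩ := Ideal.mem_span_range_iff_exists_fun.1 hx
      let v : (Fin r × Σ j : Fin s, Fin (m j)) →
          Polynomial (MvPolynomial (Fin r × Σ j : Fin s, Fin (m j)) R) := fun z =>
        Polynomial.C (X z) + if hz : z.1 = i ∧ z.2.1 = j then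
          Polynomial.C (h (Fin.cast (congrArg m hz.2) z.2.2)) * Polynomial.X else 0
      let φ := eval₂Hom (Polynomial.C.comp C) v
      have hC : ∀ a, φ (C a) = Polynomial.C (C a) := fun a => by simp [φ]
      have hX : ∀ z, φ (X z) = v z := fun z => by simp [φ]
      refine ⟨φ, fun b => ?_, fun i' j' hne => ?_, ?_⟩
      · have : (Polynomial.evalRingHom 0).comp φ = RingHom.id _ := by
          refine MvPolynomial.ringHom_ext (fun a => by simp [hC]) fun z => ?_
          simp only [RingHom.comp_apply, hX, v]
          split_ifs <;> simp
        exact congrArg (fun ψ => ψ b) this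
      · have hv : ∀ k, v (i', ⟨j', k⟩) = Polynomial.C (X (i', ⟨j', k⟩)) := fun k => by
          have : ¬ (i' = i ∧ j' = j) := fun ⟨h1, h2⟩ => hne (by rw [h1, h2])
          simp [v, this]
        simp [hM, hC, hX, hv]
      · have hv : ∀ k, v (i, ⟨j, k⟩) =
            Polynomial.C (X (i, ⟨j, k⟩)) + Polynomial.C (h k) * Polynomial.X := fun k => by
          simp [v]
        simp only [hM, map_sum, map_mul, hC, hX, hv, mul_add, Finset.sum_add_distrib,
          Function.comp_apply, Finset.sum_mul]
        refine congrArg _ (Finset.sum_congr rfl fun k _ => ?_)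
        rw [← mul_assoc, mul_comm (Polynomial.C (C _))]
end

section
/- Let A be a Noetherian domain, R = A[x_0,…,x_r], 𝓘 ⊆ R an ideal generated by forms of the same degree d > 0, and n ⊂ A a maximal ideal. Suppose that for every prime P of R containing (𝓘, n) the analytic spread satisfies ℓ(𝓘_P) ≤ ht(P/nR) + k for a fixed integer k ≥ 0. Then dim(gr_𝓘(R) ⊗_A A/n) ≤ dim(R/nR) + k = r + 1 + k. -/
set_option synthInstance.maxHeartbeats 1000000
set_option maxHeartbeats 1000000
set_option maxSynthPendingDepth 5

universe u

theorem ringKrullDim_eq_of_isIntegral_of_injective {R S : Type*} [CommRing R] [CommRing S]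
    [Algebra R S] [Algebra.IsIntegral R S] (hinj : Function.Injective (algebraMap R S)) :
    ringKrullDim S = ringKrullDim R := by
  apply le_antisymm
  · refine Order.krullDim_le_of_strictMono (PrimeSpectrum.comap (algebraMap R S)) fun p q hpq ↦ ?_
    exact Ideal.IsIntegral.comap_lt_comap (R := R) hpq
  · refine iSup_le fun l ↦ ?_
    obtain ⟨P, -, hP, hPl⟩ := Ideal.exists_ideal_over_prime_of_isIntegral l.head.asIdeal (⊥ : Ideal S)
      (by rw [← RingHom.ker_eq_comap_bot, (RingHom.injective_iff_ker_eq_bot _).1 hinj]; exact bot_le)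
    have : P.LiesOver l.head.asIdeal := ⟨hPl.symm⟩
    obtain ⟨L, hL, -⟩ := Ideal.exists_ltSeries_of_hasGoingUp l P
    exact hL ▸ Order.LTSeries.length_le_krullDim L

theorem exists_nat_ringKrullDim_eq_and_trdeg_eq (K D : Type u) [Field K] [CommRing D] [IsDomain D]
    [Algebra K D] [Algebra.FiniteType K D] :
    ∃ s : ℕ, ringKrullDim D = s ∧ Algebra.trdeg K D = s := by
  obtain ⟨s, g, hg, hg'⟩ := exists_integral_inj_algHom_of_fg K D
  algebraize [g.toRingHom]
  have hinj : Function.Injective (algebraMap (MvPolynomial (Fin s) K) D) := hg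
  have : Algebra.IsIntegral (MvPolynomial (Fin s) K) D := ⟨hg'⟩
  have : FaithfulSMul (MvPolynomial (Fin s) K) D := (faithfulSMul_iff_algebraMap_injective _ _).2 hinj
  have : IsScalarTower K (MvPolynomial (Fin s) K) D := .of_algebraMap_eq fun x ↦ (g.commutes x).symm
  refine ⟨s, ?_, ?_⟩
  · rw [ringKrullDim_eq_of_isIntegral_of_injective hinj, MvPolynomial.ringKrullDim_of_isNoetherianRing,
      ringKrullDim_eq_zero_of_field]
    simp
  · rw [← trdeg_add_eq K (MvPolynomial (Fin s) K) (A := D),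
      trdeg_eq_zero (R := MvPolynomial (Fin s) K)]
    simp

theorem ringKrullDim_le_add_ringKrullDim_localization (K T D : Type u) [Field K] [CommRing T]
    [IsDomain T] [CommRing D] [IsDomain D] [Algebra K T] [Algebra K D] [Algebra T D]
    [IsScalarTower K T D] [FaithfulSMul T D] [Algebra.FiniteType K T] [Algebra.FiniteType K D] :
    ringKrullDim D ≤ ringKrullDim T +
      ringKrullDim (Localization (Algebra.algebraMapSubmonoid D (nonZeroDivisors T))) := by
  set E := Localization (Algebra.algebraMapSubmonoid D (nonZeroDivisors T))
  have hle : Algebra.algebraMapSubmonoid D (nonZeroDivisors T) ≤ nonZeroDivisors D :=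
    map_le_nonZeroDivisors_of_injective _ (FaithfulSMul.algebraMap_injective T D) le_rfl
  have : IsDomain E := IsLocalization.isDomain_localization hle
  have hDE : Function.Injective (algebraMap D E) := IsLocalization.injective E hle
  have : FaithfulSMul D E := (faithfulSMul_iff_algebraMap_injective _ _).2 hDE
  have : FaithfulSMul T E := (faithfulSMul_iff_algebraMap_injective _ _).2 (by
    rw [IsScalarTower.algebraMap_eq T D E]
    exact hDE.comp (FaithfulSMul.algebraMap_injective T D))
  have : Algebra.FiniteType T D := .of_restrictScalars_finiteType K T D
  have : IsLocalization ((nonZeroDivisors T).map (algebraMap T D)) E :=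
    inferInstanceAs (IsLocalization (Algebra.algebraMapSubmonoid D (nonZeroDivisors T)) E)
  have : Algebra.FiniteType (FractionRing T) E :=
    RingHom.finiteType_localizationPreserves (algebraMap T D) (nonZeroDivisors T) (FractionRing T) E
      (by rwa [RingHom.finiteType_algebraMap])
  have : Algebra.IsAlgebraic T (FractionRing T) :=
    IsLocalization.isAlgebraic (FractionRing T) (nonZeroDivisors T)
  have : Algebra.IsAlgebraic D E :=
    IsLocalization.isAlgebraic E (Algebra.algebraMapSubmonoid D (nonZeroDivisors T))
  obtain ⟨a, ha, ha'⟩ := exists_nat_ringKrullDim_eq_and_trdeg_eq K D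
  obtain ⟨b, hb, hb'⟩ := exists_nat_ringKrullDim_eq_and_trdeg_eq K T
  obtain ⟨c, hc, hc'⟩ := exists_nat_ringKrullDim_eq_and_trdeg_eq (FractionRing T) E
  have h1 := trdeg_add_eq K T (A := D)
  have h2 := trdeg_add_eq T D (A := E)
  have h3 := trdeg_add_eq T (FractionRing T) (A := E)
  rw [trdeg_eq_zero (R := D), add_zero] at h2
  rw [trdeg_eq_zero (R := T), zero_add] at h3
  rw [h2, ← h3, ha', hb', hc'] at h1
  rw [ha, hb, hc]
  have : b + c = a := by exact_mod_cast h1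
  exact_mod_cast this.ge

theorem Ideal.ringKrullDim_quotient_add_height_le {S : Type*} [CommRing S] (Q : PrimeSpectrum S) :
    ringKrullDim (S ⧸ Q.asIdeal) + (Order.height Q : WithBot ℕ∞) ≤ ringKrullDim S := by
  have : Nonempty (PrimeSpectrum S) := ⟨Q⟩
  have h : ringKrullDim (S ⧸ Q.asIdeal) = (Order.coheight Q : WithBot ℕ∞) := by
    rw [ringKrullDim_quotient, Order.coheight_eq_krullDim_Ici]
    rfl
  rw [h, ringKrullDim, Order.krullDim_eq_iSup_height_add_coheight_of_nonempty, add_comm]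
  exact_mod_cast le_iSup (fun a : PrimeSpectrum S ↦ Order.height a + Order.coheight a) Q

theorem ringKrullDim_le_of_forall_quotient_prime {S : Type*} [CommRing S] {N : WithBot ℕ∞}
    (h : ∀ Q : Ideal S, Q.IsPrime → ringKrullDim (S ⧸ Q) ≤ N) : ringKrullDim S ≤ N := by
  rw [ringKrullDim, Order.krullDim_eq_iSup_coheight]
  refine iSup_le fun Q ↦ le_trans (le_of_eq ?_) (h Q.asIdeal Q.isPrime)
  rw [ringKrullDim_quotient, Order.coheight_eq_krullDim_Ici]
  rfl

theorem ringKrullDim_le_quotient_ker_add_localization {K S D : Type u} [Field K] [CommRing S]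
    [CommRing D] [IsDomain D] [Algebra K S] [Algebra S D] [Algebra.FiniteType K S]
    [Algebra.FiniteType S D] (Q : Ideal S) [Q.IsPrime] (hQ : RingHom.ker (algebraMap S D) = Q) :
    ringKrullDim D ≤ ringKrullDim (S ⧸ Q) +
      ringKrullDim (Localization (Algebra.algebraMapSubmonoid D Q.primeCompl)) := by
  let f : S ⧸ Q →+* D := Ideal.Quotient.lift Q (algebraMap S D) fun a ha ↦ by
    rwa [← RingHom.mem_ker, hQ]
  have hf : Function.Injective f := RingHom.lift_injective_of_ker_le_ideal _ _ hQ.le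
  let _ : Algebra (S ⧸ Q) D := f.toAlgebra
  let _ : Algebra K D := ((algebraMap S D).comp (algebraMap K S)).toAlgebra
  have : IsScalarTower K S D := .of_algebraMap_eq fun _ ↦ rfl
  have : IsScalarTower K (S ⧸ Q) D := .of_algebraMap_eq fun _ ↦ rfl
  have : FaithfulSMul (S ⧸ Q) D := (faithfulSMul_iff_algebraMap_injective _ _).2 hf
  have : Algebra.FiniteType K D := .trans (S := S) inferInstance inferInstance
  have : Algebra.algebraMapSubmonoid D (nonZeroDivisors (S ⧸ Q)) =
      Algebra.algebraMapSubmonoid D Q.primeCompl := by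
    ext x
    constructor
    · rintro ⟨y, hy, rfl⟩
      obtain ⟨y, rfl⟩ := Ideal.Quotient.mk_surjective y
      refine ⟨y, fun h ↦ nonZeroDivisors.ne_zero hy (Ideal.Quotient.eq_zero_iff_mem.2 h), rfl⟩
    · rintro ⟨y, hy, rfl⟩
      exact ⟨Ideal.Quotient.mk Q y, mem_nonZeroDivisors_of_ne_zero fun h ↦
        hy (Ideal.Quotient.eq_zero_iff_mem.1 h), rfl⟩
  rw [← this]
  exact ringKrullDim_le_add_ringKrullDim_localization K (S ⧸ Q) D

section Rees

variable {R : Type*} [CommRing R] (I : Ideal R) (R' : Type*) [CommRing R'] [Algebra R R']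

open Polynomial

/-- The map of Rees algebras induced by extending an ideal along an algebra map. -/
noncomputable def reesAlgebraMap :
    reesAlgebra I →+* reesAlgebra (I.map (algebraMap R R')) :=
  ((mapRingHom (algebraMap R R')).comp (reesAlgebra I).val.toRingHom).codRestrict
    (reesAlgebra (I.map (algebraMap R R'))) fun f i ↦ by
      simpa [← Ideal.map_pow] using Ideal.mem_map_of_mem (algebraMap R R') (f.2 i)

@[simp]
theorem coe_reesAlgebraMap (f : reesAlgebra I) :
    (reesAlgebraMap I R' f : R'[X]) = (f : R[X]).map (algebraMap R R') := rfl

theorem reesAlgebraMap_algebraMap (x : R) :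
    reesAlgebraMap I R' (algebraMap R _ x) = algebraMap R' _ (algebraMap R R' x) :=
  Subtype.ext (by simp)

theorem exists_smul_mem_range_reesAlgebraMap (M : Submonoid R) [IsLocalization M R']
    (f : reesAlgebra (I.map (algebraMap R R'))) :
    ∃ s ∈ M, ∃ g : reesAlgebra I,
      algebraMap R' _ (algebraMap R R' s) * f = reesAlgebraMap I R' g := by
  suffices H : ∀ p ∈ Algebra.adjoin R' (Submodule.map (monomial 1 : R' →ₗ[R'] R'[X])
      (I.map (algebraMap R R')) : Set R'[X]), ∃ s ∈ M, ∃ g ∈ reesAlgebra I,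
      C (algebraMap R R' s) * p = g.map (algebraMap R R') by
    obtain ⟨s, hs, g, hg, h⟩ := H (f : R'[X]) ((adjoin_monomial_eq_reesAlgebra (I.map (algebraMap R R'))).symm ▸ f.2)
    exact ⟨s, hs, ⟨g, hg⟩, Subtype.ext h⟩
  intro p hp
  induction hp using Algebra.adjoin_induction with
  | mem x hx =>
    obtain ⟨y, hy, rfl⟩ := hx
    obtain ⟨⟨a, s⟩, h⟩ := (IsLocalization.mem_map_algebraMap_iff M R').1 hy
    refine ⟨s, s.2, monomial 1 (a : R), reesAlgebra.monomial_mem.2 (by simp), ?_⟩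
    simp only at h
    rw [C_mul_monomial, map_monomial, ← h, mul_comm]
  | algebraMap x =>
    obtain ⟨⟨a, s⟩, h⟩ := IsLocalization.surj M x
    refine ⟨s, s.2, C a, (reesAlgebra I).algebraMap_mem a, ?_⟩
    simp only at h
    rw [← C_eq_algebraMap, map_C, ← h, mul_comm, C_mul]
  | add x y _ _ hx hy =>
    obtain ⟨s, hs, g, hg, h⟩ := hx
    obtain ⟨s', hs', g', hg', h'⟩ := hy
    refine ⟨s * s', mul_mem hs hs', s' • g + s • g', add_mem (Subalgebra.smul_mem _ hg _)
      (Subalgebra.smul_mem _ hg' _), ?_⟩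
    simp only [smul_eq_C_mul, Polynomial.map_add, Polynomial.map_mul, ← h, ← h', map_C, map_mul]
    ring
  | mul x y _ _ hx hy =>
    obtain ⟨s, hs, g, hg, h⟩ := hx
    obtain ⟨s', hs', g', hg', h'⟩ := hy
    refine ⟨s * s', mul_mem hs hs', g * g', mul_mem hg hg', ?_⟩
    simp only [Polynomial.map_mul, ← h, ← h', map_mul]
    ring

attribute [local instance] Polynomial.isLocalization in
theorem exists_mul_eq_of_reesAlgebraMap_eq (M : Submonoid R) [IsLocalization M R']
    {f g : reesAlgebra I} (h : reesAlgebraMap I R' f = reesAlgebraMap I R' g) :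
    ∃ s ∈ M, algebraMap R _ s * f = algebraMap R _ s * g := by
  let _ := (mapRingHom (algebraMap R R')).toAlgebra
  obtain ⟨⟨_, s, hs, rfl⟩, h⟩ := IsLocalization.exists_of_eq (M := M.map (C : R →+* R[X])) (S := R'[X])
    (x := (f : R[X])) (y := (g : R[X])) (congrArg Subtype.val h)
  exact ⟨s, hs, Subtype.ext h⟩

theorem isLocalization_reesAlgebra (M : Submonoid R) [IsLocalization M R'] :
    letI := (reesAlgebraMap I R').toAlgebra
    IsLocalization (Algebra.algebraMapSubmonoid (reesAlgebra I) M)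
      (reesAlgebra (I.map (algebraMap R R'))) := by
  let _ := (reesAlgebraMap I R').toAlgebra
  refine ⟨?_, ?_, ?_⟩
  · rintro ⟨_, s, hs, rfl⟩
    change IsUnit (reesAlgebraMap I R' (algebraMap R _ s))
    rw [reesAlgebraMap_algebraMap]
    exact (IsLocalization.map_units R' ⟨s, hs⟩).map _
  · intro f
    obtain ⟨s, hs, g, h⟩ := exists_smul_mem_range_reesAlgebraMap I R' M f
    refine ⟨⟨g, ⟨_, s, hs, rfl⟩⟩, ?_⟩
    rw [mul_comm]
    change reesAlgebraMap I R' (algebraMap R _ s) * f = _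
    rw [reesAlgebraMap_algebraMap, h]
    rfl
  · intro f g h
    obtain ⟨s, hs, h⟩ := exists_mul_eq_of_reesAlgebraMap_eq I R' M h
    exact ⟨⟨_, s, hs, rfl⟩, h⟩

theorem ringKrullDim_localization_le_fiberCone {D : Type*} [CommRing D] (P : Ideal R) [P.IsPrime]
    (φ : reesAlgebra I →+* D) (hφ : Function.Surjective φ)
    (hP : ∀ p ∈ P, φ (algebraMap R _ p) = 0) (N : Submonoid D)
    (hN : N = P.primeCompl.map (φ.comp (algebraMap R (reesAlgebra I)))) :
    ringKrullDim (Localization N) ≤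
      ringKrullDim (reesAlgebra (I.map (algebraMap R (Localization.AtPrime P))) ⧸
        (IsLocalRing.maximalIdeal (Localization.AtPrime P)).map
          (algebraMap (Localization.AtPrime P)
            (reesAlgebra (I.map (algebraMap R (Localization.AtPrime P)))))) := by
  let _ := (reesAlgebraMap I (Localization.AtPrime P)).toAlgebra
  have := isLocalization_reesAlgebra I (Localization.AtPrime P) P.primeCompl
  have hunit : ∀ y : Algebra.algebraMapSubmonoid (reesAlgebra I) P.primeCompl,
      IsUnit ((algebraMap D (Localization N)).comp φ y) := by
    rintro ⟨_, s, hs, rfl⟩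
    have hmem : φ (algebraMap R _ s) ∈ N := by
      rw [hN]
      exact ⟨s, hs, rfl⟩
    exact IsLocalization.map_units (Localization N) ⟨_, hmem⟩
  let ψ : reesAlgebra (I.map (algebraMap R (Localization.AtPrime P))) →+* Localization N :=
    IsLocalization.lift hunit
  have hψ (x) : ψ (reesAlgebraMap I _ x) = algebraMap D _ (φ x) := IsLocalization.lift_eq hunit x
  have hsurj : Function.Surjective ψ := by
    intro e
    obtain ⟨d, ⟨t, ht⟩, rfl⟩ := IsLocalization.exists_mk'_eq N e
    obtain ⟨s, hs, rfl⟩ := hN ▸ ht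
    obtain ⟨x, rfl⟩ := hφ d
    refine ⟨IsLocalization.mk' _ x (⟨_, s, hs, rfl⟩ :
      Algebra.algebraMapSubmonoid (reesAlgebra I) P.primeCompl), ?_⟩
    rw [IsLocalization.lift_mk'_spec, RingHom.comp_apply, RingHom.comp_apply, mul_comm]
    exact (IsLocalization.mk'_spec (Localization N) (φ x) ⟨_, ht⟩).symm
  refine ringKrullDim_le_of_surjective (Ideal.Quotient.lift _ ψ fun a ha ↦ ?_)
    (Ideal.Quotient.lift_surjective_of_surjective _ _ hsurj)
  rw [← RingHom.mem_ker]
  refine (?_ : Ideal.map _ _ ≤ RingHom.ker ψ) ha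
  rw [← Localization.AtPrime.map_eq_maximalIdeal, Ideal.map_le_iff_le_comap,
    Ideal.map_le_iff_le_comap]
  intro p hp
  rw [Ideal.mem_comap, Ideal.mem_comap, RingHom.mem_ker, ← reesAlgebraMap_algebraMap, hψ,
    hP p hp, map_zero]

end Rees

/-- Let `A` be a Noetherian domain, `R = A[x₀,…,x_r]`, `𝓘 ⊆ R` an ideal
generated by forms of the same degree `d > 0`, and `n ⊂ A` a maximal ideal.  Suppose that
for every prime `P` of `R` containing `(𝓘, nR)` the analytic spread satisfies
`ℓ(𝓘_P) ≤ ht(P/nR) + k` for a fixed integer `k ≥ 0` — here primes containing `nR` are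
parametrized as preimages of primes `Q` of `R/nR`, the analytic spread is the dimension of
the fiber cone `Rees(𝓘_P)/(max ideal)·Rees(𝓘_P)` of `𝓘_P ⊆ R_P`, and `ht(P/nR)` is
`Order.height` of `Q` in `Spec (R/nR)`.  Then
`dim (gr_𝓘(R) ⊗_A A/n) ≤ dim (R/nR) + k = r + 1 + k`, the associated graded ring being
realized as `gr_𝓘(R) = Rees_R(𝓘)/𝓘·Rees_R(𝓘)`. -/
theorem stmt_18 {A : Type*} [CommRing A] [IsDomain A] [IsNoetherianRing A]
    (r : ℕ) (𝓘 : Ideal (MvPolynomial (Fin (r + 1)) A))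
    (d : ℕ) (hd : 0 < d) (gens : Set (MvPolynomial (Fin (r + 1)) A))
    (hgens : ∀ g ∈ gens, MvPolynomial.IsHomogeneous g d) (h𝓘 : 𝓘 = Ideal.span gens)
    (n : Ideal A) (hn : n.IsMaximal)
    (nR : Ideal (MvPolynomial (Fin (r + 1)) A))
    (hnR : nR = n.map (algebraMap A (MvPolynomial (Fin (r + 1)) A)))
    (k : ℕ)
    (hspread : ∀ Q : Ideal (MvPolynomial (Fin (r + 1)) A ⧸ nR), ∀ hQ : Q.IsPrime,
      𝓘 ≤ Q.comap (Ideal.Quotient.mk nR) →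
      ringKrullDim
        (↥(reesAlgebra (𝓘.map (algebraMap (MvPolynomial (Fin (r + 1)) A)
            (Localization.AtPrime (Q.comap (Ideal.Quotient.mk nR)))))) ⧸
          (IsLocalRing.maximalIdeal
              (Localization.AtPrime (Q.comap (Ideal.Quotient.mk nR)))).map
            (algebraMap (Localization.AtPrime (Q.comap (Ideal.Quotient.mk nR)))
              ↥(reesAlgebra (𝓘.map (algebraMap (MvPolynomial (Fin (r + 1)) A)
                (Localization.AtPrime (Q.comap (Ideal.Quotient.mk nR)))))))) ≤
        ((Order.height (⟨Q, hQ⟩ : PrimeSpectrum (MvPolynomial (Fin (r + 1)) A ⧸ nR)) :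
            WithBot ℕ∞) + (k : WithBot ℕ∞))) :
    ringKrullDim (TensorProduct A
        (↥(reesAlgebra 𝓘) ⧸
          𝓘.map (algebraMap (MvPolynomial (Fin (r + 1)) A) ↥(reesAlgebra 𝓘)))
        (A ⧸ n)) ≤
      (((r + 1 + k : ℕ)) : WithBot ℕ∞) := by
  subst hnR
  let _ : Field (A ⧸ n) := Ideal.Quotient.field n
  let S := MvPolynomial (Fin (r + 1)) A ⧸ n.map (algebraMap A (MvPolynomial (Fin (r + 1)) A))
  let _ : Algebra (A ⧸ n) S := (Ideal.Quotient.lift n (algebraMap A S) fun a ha ↦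
    Ideal.Quotient.eq_zero_iff_mem.2 (Ideal.mem_map_of_mem _ ha)).toAlgebra
  have : IsScalarTower A (A ⧸ n) S := .of_algebraMap_eq fun _ ↦ rfl
  have : Algebra.FiniteType (A ⧸ n) S := .of_restrictScalars_finiteType A (A ⧸ n) S
  have hdimS : ringKrullDim S = ((r + 1 : ℕ) : WithBot ℕ∞) := by
    rw [← show _ = ringKrullDim S from ringKrullDim_eq_of_ringEquiv
      (MvPolynomial.quotientEquivQuotientMvPolynomial n (σ := Fin (r + 1))).toRingEquiv,
      MvPolynomial.ringKrullDim_of_isNoetherianRing, ringKrullDim_eq_zero_of_field]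
    simp
  refine ringKrullDim_le_of_forall_quotient_prime fun q hq ↦ ?_
  let B := reesAlgebra 𝓘 ⧸ 𝓘.map (algebraMap (MvPolynomial (Fin (r + 1)) A) (reesAlgebra 𝓘))
  let φ : reesAlgebra 𝓘 →+* TensorProduct A B (A ⧸ n) ⧸ q :=
    (Ideal.Quotient.mk q).comp ((Algebra.TensorProduct.includeLeftRingHom).comp
      (Ideal.Quotient.mk _))
  have hφ : Function.Surjective φ :=
    Ideal.Quotient.mk_surjective.comp
      ((Algebra.TensorProduct.includeLeft_surjective (S := A) _ Ideal.Quotient.mk_surjective).comp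
        Ideal.Quotient.mk_surjective)
  let f := φ.comp (algebraMap (MvPolynomial (Fin (r + 1)) A) (reesAlgebra 𝓘))
  have hf𝓘 : ∀ x ∈ 𝓘, f x = 0 := fun x hx ↦ by
    have : Ideal.Quotient.mk (𝓘.map (algebraMap _ (reesAlgebra 𝓘)))
        (algebraMap (MvPolynomial (Fin (r + 1)) A) (reesAlgebra 𝓘) x) = 0 :=
      Ideal.Quotient.eq_zero_iff_mem.2 (Ideal.mem_map_of_mem _ hx)
    simp [f, φ, this]
  have hfn : n.map (algebraMap A (MvPolynomial (Fin (r + 1)) A)) ≤ RingHom.ker f := by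
    refine Ideal.map_le_iff_le_comap.2 fun a ha ↦ ?_
    have h : (algebraMap A B a) ⊗ₜ[A] (1 : A ⧸ n) = 0 := by
      rw [Algebra.algebraMap_eq_smul_one, TensorProduct.smul_tmul, ← Algebra.algebraMap_eq_smul_one,
        Ideal.Quotient.algebraMap_eq, Ideal.Quotient.eq_zero_iff_mem.2 ha, TensorProduct.tmul_zero]
    change Ideal.Quotient.mk q ((algebraMap A B a) ⊗ₜ[A] (1 : A ⧸ n)) = 0
    rw [h, map_zero]
  let g : S →+* TensorProduct A B (A ⧸ n) ⧸ q := Ideal.Quotient.lift _ f hfn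
  let _ : Algebra S (TensorProduct A B (A ⧸ n) ⧸ q) := g.toAlgebra
  have hft : f.FiniteType := (RingHom.FiniteType.of_surjective φ hφ).comp
    (RingHom.finiteType_algebraMap.2 inferInstance)
  have : Algebra.FiniteType S (TensorProduct A B (A ⧸ n) ⧸ q) :=
    RingHom.finiteType_algebraMap.1 (RingHom.FiniteType.of_comp_finiteType
      (f := Ideal.Quotient.mk _) (g := g) hft)
  let Q : Ideal S := RingHom.ker g
  have hQ : Q.IsPrime := RingHom.ker_isPrime g
  have hN : Algebra.algebraMapSubmonoid (TensorProduct A B (A ⧸ n) ⧸ q) Q.primeCompl =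
      (Q.comap (Ideal.Quotient.mk _)).primeCompl.map f := by
    ext x
    constructor
    · rintro ⟨y, hy, rfl⟩
      obtain ⟨y, rfl⟩ := Ideal.Quotient.mk_surjective y
      exact ⟨y, hy, rfl⟩
    · rintro ⟨y, hy, rfl⟩
      exact ⟨Ideal.Quotient.mk _ y, hy, rfl⟩
  calc
    _ ≤ _ := ringKrullDim_le_quotient_ker_add_localization (K := A ⧸ n) Q rfl
    _ ≤ ringKrullDim (S ⧸ Q) + (Order.height (⟨Q, hQ⟩ : PrimeSpectrum S) + (k : WithBot ℕ∞)) := by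
      gcongr
      exact (ringKrullDim_localization_le_fiberCone 𝓘 (Q.comap (Ideal.Quotient.mk _)) φ hφ
        (fun p hp ↦ hp) _ hN).trans (hspread Q hQ fun x hx ↦ hf𝓘 x hx)
    _ ≤ ringKrullDim S + k := by
      rw [← add_assoc]
      gcongr
      exact Ideal.ringKrullDim_quotient_add_height_le (⟨Q, hQ⟩ : PrimeSpectrum S)
    _ = _ := by
      rw [hdimS]
      push_cast
      rfl
end
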